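/- For every pair of distinct numbers p, q ∈ (0,1) there exists a sequence of finite irreducible reversible Markov chains (Ω_n, P_n, π_n) such that exactly one of the following two sequences of chains exhibits separation cutoff: the sequence of p-lazy versions (Ω_n, pI + (1−p)P_n, π_n) and the sequence of q-lazy versions (Ω_n, qI + (1−q)P_n, π_n). -/

import Mathlib

open Filter Finset

noncomputable section

variable {V : Type} [Fintype V] [DecidableEq V]

/-- `P` is a row-stochastic matrix. -/
def IsStoch (P : Matrix V V ℝ) : Prop :=
  (∀ i j, 0 ≤ P i j) ∧ ∀ i, ∑ j, P i j = 1

/-- `π` is a probability vector with full support. -/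
def IsProb (π : V → ℝ) : Prop := (∀ i, 0 < π i) ∧ ∑ i, π i = 1

/-- reversibility: `π x * P x y = π y * P y x`. -/
def Rev (P : Matrix V V ℝ) (π : V → ℝ) : Prop := ∀ i j, π i * P i j = π j * P j i

/-- irreducibility -/
def Irred (P : Matrix V V ℝ) : Prop := ∀ i j, ∃ t : ℕ, 0 < (P ^ t) i j

/-- the lazy version `(I + P)/2` of a chain -/
def lazyM (P : Matrix V V ℝ) : Matrix V V ℝ := (2 : ℝ)⁻¹ • (1 + P)

/-- total variation distance -/
def tvDist (μ ν : V → ℝ) : ℝ := (∑ x, |μ x - ν x|) / 2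

/-- worst-case total variation distance from stationarity at time `t` -/
def dTV (P : Matrix V V ℝ) (π : V → ℝ) (t : ℕ) : ℝ := ⨆ x, tvDist ((P ^ t) x) π

/-- the `ε` total-variation mixing time -/
def mixTime (P : Matrix V V ℝ) (π : V → ℝ) (ε : ℝ) : ℕ := sInf {t : ℕ | dTV P π t ≤ ε}

/-- worst-case separation distance at time `t` -/
def dSep (P : Matrix V V ℝ) (π : V → ℝ) (t : ℕ) : ℝ := 1 - ⨅ x, ⨅ y, ((P ^ t) x y) / π y

/-- the `ε` separation time -/
def sepTime (P : Matrix V V ℝ) (π : V → ℝ) (ε : ℝ) : ℕ := sInf {t : ℕ | dSep P π t ≤ ε}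

/-- the heat kernel `H_t = exp (t (P - I))` of the associated continuous-time chain -/
def heatKer (P : Matrix V V ℝ) (t : ℝ) : Matrix V V ℝ :=
  ∑' k : ℕ, (t ^ k / (Nat.factorial k : ℝ)) • ((P - 1) ^ k)

/-- separation distance of the continuous-time chain -/
def dSepC (P : Matrix V V ℝ) (π : V → ℝ) (t : ℝ) : ℝ := 1 - ⨅ x, ⨅ y, (heatKer P t) x y / π y

/-- the `ε` separation time of the continuous-time chain -/
def sepTimeC (P : Matrix V V ℝ) (π : V → ℝ) (ε : ℝ) : ℝ := sInf {t : ℝ | 0 ≤ t ∧ dSepC P π t ≤ ε}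

/-- degree of a vertex -/
def deg (G : SimpleGraph V) (v : V) : ℕ := Nat.card {u // G.Adj v u}

open Classical in
/-- transition matrix of the lazy simple random walk on `G` -/
def walkMat (G : SimpleGraph V) : Matrix V V ℝ :=
  Matrix.of fun v u => if v = u then 1/2 else if G.Adj v u then 1 / (2 * (deg G v : ℝ)) else 0

/-- stationary distribution of the (lazy) simple random walk on `G` -/
def degSta (G : SimpleGraph V) (v : V) : ℝ := (deg G v : ℝ) / ∑ u, (deg G u : ℝ)

/-- the `ε` total-variation mixing time of the lazy simple random walk on `G` -/
def tmixG (G : SimpleGraph V) (ε : ℝ) : ℕ := mixTime (walkMat G) (degSta G) ε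

/-- the second largest eigenvalue of a reversible transition matrix -/
def lam2 (P : Matrix V V ℝ) : ℝ :=
  sSup {μ : ℝ | μ ≠ 1 ∧ ∃ f : V → ℝ, f ≠ 0 ∧ P.mulVec f = μ • f}

/-- the relaxation time `1/(1-λ₂)` -/
def trel (P : Matrix V V ℝ) : ℝ := 1 / (1 - lam2 P)

/-- the relaxation time of the lazy simple random walk on `G` -/
def trelG (G : SimpleGraph V) : ℝ := trel (walkMat G)

/-- transition matrix of the lazy random walk on the network with edge weights `w` -/
def wMat (w : V → V → ℝ) : Matrix V V ℝ :=
  Matrix.of fun v u => if v = u then 1/2 else w v u / (2 * ∑ x, w v x)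

/-- stationary distribution of the lazy random walk on the network with edge weights `w` -/
def wSta (w : V → V → ℝ) (v : V) : ℝ := (∑ x, w v x) / ∑ u, ∑ x, w u x

/-- `w` is a valid system of edge weights on the graph `G`: symmetric, positive on edges
and vanishing off the edges. -/
def GoodWeights (G : SimpleGraph V) (w : V → V → ℝ) : Prop :=
  (∀ u v, w u v = w v u) ∧ (∀ u v, G.Adj u v → 0 < w u v) ∧ ∀ u v, ¬ G.Adj u v → w u v = 0

/-- the `ε` total-variation mixing time of the lazy random walk on the weighted network -/
def tmixW (w : V → V → ℝ) (ε : ℝ) : ℕ := mixTime (wMat w) (wSta w) ε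

/-- the probability of a discrete trajectory -/
def pathProb (P : Matrix V V ℝ) {k : ℕ} (w : Fin (k+1) → V) : ℝ :=
  ∏ i : Fin k, P (w i.castSucc) (w i.succ)

/-- `P_x[T_y = k]`: probability that the chain started at `x` first hits `y` at time `k` -/
def firstHit (P : Matrix V V ℝ) (x y : V) (k : ℕ) : ℝ :=
  ∑ w : Fin (k+1) → V,
    if w 0 = x ∧ w (Fin.last k) = y ∧ ∀ i : Fin k, w i.castSucc ≠ y then pathProb P w else 0

/-- the restriction of `P - I` to the complement of `y` -/
def restrQ (P : Matrix V V ℝ) (y : V) : Matrix {w : V // w ≠ y} {w : V // w ≠ y} ℝ :=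
  Matrix.of fun a b => P a.1 b.1 - if a = b then 1 else 0

/-- `exp (t A)` where `A` is the restriction of `P - I` to the complement of `y` -/
def heatRestr (P : Matrix V V ℝ) (y : V) (t : ℝ) :
    Matrix {w : V // w ≠ y} {w : V // w ≠ y} ℝ :=
  ∑' k : ℕ, (t ^ k / (Nat.factorial k : ℝ)) • (restrQ P y ^ k)

/-- `P_x[T_B < r]` for the chain `P`: the probability that the set `B` is hit before time `r` -/
def hitByTime (P : Matrix V V ℝ) (B : Finset V) (x : V) (r : ℕ) : ℝ :=
  ∑ k ∈ Finset.range r, ∑ w : Fin (k+1) → V,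
    if w 0 = x ∧ w (Fin.last k) ∈ B ∧ ∀ i : Fin k, w i.castSucc ∉ B then pathProb P w else 0


/-- the `δ`-lazy version `δ I + (1-δ) P` of a chain -/
def dLazy (δ : ℝ) (P : Matrix V V ℝ) : Matrix V V ℝ := δ • (1 : Matrix V V ℝ) + (1 - δ) • P

set_option linter.unusedSectionVars false

section Generic

variable {M : Matrix V V ℝ} {π : V → ℝ}

theorem IsStoch.pow (hM : IsStoch M) (t : ℕ) : IsStoch (M ^ t) := by
  induction t with
  | zero =>
    refine ⟨fun i j => ?_, fun i => ?_⟩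
    · rw [pow_zero, Matrix.one_apply]; split_ifs <;> norm_num
    · simp [Matrix.one_apply]
  | succ t ih =>
    refine ⟨fun i j => ?_, fun i => ?_⟩
    · rw [pow_succ, Matrix.mul_apply]
      exact sum_nonneg fun k _ => mul_nonneg (ih.1 _ _) (hM.1 _ _)
    · simp_rw [pow_succ, Matrix.mul_apply]
      rw [sum_comm]
      simp_rw [← mul_sum, hM.2, mul_one, ih.2]

theorem IsStoch.le_one (hM : IsStoch M) (x y : V) : M x y ≤ 1 := by
  rw [← hM.2 x]
  exact single_le_sum (f := fun j => M x j) (fun j _ => hM.1 x j) (mem_univ y)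

theorem Rev.pow (hr : Rev M π) (t : ℕ) : Rev (M ^ t) π := by
  induction t with
  | zero =>
    intro i j
    by_cases h : i = j
    · subst h; rfl
    · simp [h, Ne.symm h]
  | succ t ih =>
    intro i j
    rw [pow_succ, Matrix.mul_apply, ← pow_succ, pow_succ', Matrix.mul_apply, mul_sum, mul_sum]
    refine sum_congr rfl fun k _ => ?_
    linear_combination M k j * ih i k + (M ^ t) k i * hr k j

theorem pow_add_ge (hM : IsStoch M) (s u : ℕ) (x v y : V) :
    (M ^ s) x v * (M ^ u) v y ≤ (M ^ (s + u)) x y := by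
  rw [pow_add, Matrix.mul_apply]
  exact single_le_sum (f := fun j => (M ^ s) x j * (M ^ u) j y)
    (fun j _ => mul_nonneg ((hM.pow s).1 _ _) ((hM.pow u).1 _ _)) (mem_univ v)

theorem two_leg (hM : IsStoch M) (hπ : IsProb π) (hr : Rev M π) (s u : ℕ) (x v y : V) :
    (M ^ s) x v * (M ^ u) y v / π v ≤ (M ^ (s + u)) x y / π y := by
  have hv := hπ.1 v
  have hy := hπ.1 y
  have h1 : (M ^ u) y v / π v = (M ^ u) v y / π y := by
    have := hr.pow u v y
    field_simp
    linarith
  rw [mul_div_assoc, h1, ← mul_div_assoc]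
  exact div_le_div_of_nonneg_right (pow_add_ge hM s u x v y) hy.le

theorem dSep_le [Nonempty V] {c : ℝ} {t : ℕ} (h : ∀ x y, c ≤ (M ^ t) x y / π y) :
    dSep M π t ≤ 1 - c := by
  unfold dSep
  have : c ≤ ⨅ x, ⨅ y, (M ^ t) x y / π y := le_ciInf fun x => le_ciInf fun y => h x y
  linarith

theorem le_dSep (M : Matrix V V ℝ) (π : V → ℝ) (t : ℕ) (x y : V) :
    1 - (M ^ t) x y / π y ≤ dSep M π t := by
  unfold dSep
  have h1 : ⨅ x, ⨅ y, (M ^ t) x y / π y ≤ ⨅ y, (M ^ t) x y / π y :=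
    ciInf_le (Set.finite_range _).bddBelow x
  have h2 : ⨅ y, (M ^ t) x y / π y ≤ (M ^ t) x y / π y :=
    ciInf_le (Set.finite_range _).bddBelow y
  linarith

theorem dSep_succ_le [Nonempty V] (hM : IsStoch M) (t : ℕ) :
    dSep M π (t + 1) ≤ dSep M π t := by
  have key : ∀ x y, 1 - dSep M π t ≤ (M ^ (t + 1)) x y / π y := by
    intro x y
    rw [pow_succ', Matrix.mul_apply, sum_div]
    calc 1 - dSep M π t = ∑ z, M x z * (1 - dSep M π t) := by rw [← sum_mul, hM.2, one_mul]
      _ ≤ ∑ z, M x z * (M ^ t) z y / π y := by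
        refine sum_le_sum fun z _ => ?_
        rw [mul_div_assoc]
        exact mul_le_mul_of_nonneg_left (by linarith [le_dSep M π t z y]) (hM.1 _ _)
  have := dSep_le key
  linarith

theorem dSep_antitone [Nonempty V] (hM : IsStoch M) : Antitone (dSep M π) :=
  antitone_nat_of_succ_le (dSep_succ_le hM)

theorem sepTime_le {ε : ℝ} {t : ℕ} (h : dSep M π t ≤ ε) : sepTime M π ε ≤ t :=
  Nat.sInf_le h

theorem lt_sepTime [Nonempty V] (hM : IsStoch M) {ε : ℝ} {t : ℕ} (h : ε < dSep M π t)
    (h' : ∃ t', dSep M π t' ≤ ε) : t < sepTime M π ε := by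
  by_contra! hc
  have h1 : dSep M π (sepTime M π ε) ≤ ε := Nat.sInf_mem (s := {t : ℕ | dSep M π t ≤ ε}) h'
  have := dSep_antitone (π := π) hM hc
  linarith

/-- A space-time supersolution dominates a solution of the heat equation which it dominates
at time `0` and, at all times, on the set `S`. -/
theorem le_of_supersolution (hM : ∀ x y, 0 ≤ M x y) (S : Set V) (G H : ℕ → V → ℝ)
    (hG : ∀ t v, G (t + 1) v = ∑ u, M v u * G t u) (h0 : ∀ v, G 0 v ≤ H 0 v)
    (hS : ∀ t, ∀ v ∈ S, G t v ≤ H t v)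
    (hH : ∀ t, ∀ v ∉ S, ∑ u, M v u * H t u ≤ H (t + 1) v) (t : ℕ) (v : V) : G t v ≤ H t v := by
  induction t generalizing v with
  | zero => exact h0 v
  | succ t ih =>
    by_cases hv : v ∈ S
    · exact hS _ v hv
    · rw [hG]
      exact (sum_le_sum fun u _ => mul_le_mul_of_nonneg_left (ih u) (hM v u)).trans (hH t v hv)

theorem dLazy_apply_sum (δ : ℝ) (P : Matrix V V ℝ) (f : V → ℝ) (v : V) :
    ∑ u, dLazy δ P v u * f u = δ * f v + (1 - δ) * ∑ u, P v u * f u := by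
  simp only [dLazy, Matrix.add_apply, Matrix.smul_apply, smul_eq_mul, add_mul, sum_add_distrib,
    mul_sum, mul_assoc, Matrix.one_apply]
  simp

theorem IsStoch.dLazy {P : Matrix V V ℝ} (hP : IsStoch P) {δ : ℝ} (h0 : 0 < δ) (h1 : δ < 1) :
    IsStoch (dLazy δ P) := by
  refine ⟨fun i j => ?_, fun i => ?_⟩
  · have := hP.1 i j
    have h2 : (0 : ℝ) ≤ (1 : Matrix V V ℝ) i j := by
      rw [Matrix.one_apply]; split_ifs <;> norm_num
    simp only [_root_.dLazy, Matrix.add_apply, Matrix.smul_apply, smul_eq_mul]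
    have h3 : 0 ≤ 1 - δ := by linarith
    positivity
  · have := dLazy_apply_sum δ P (fun _ => 1) i
    simp only [mul_one, hP.2] at this
    rw [this]; ring

theorem Rev.dLazy {P : Matrix V V ℝ} (hP : Rev P π) (δ : ℝ) : Rev (dLazy δ P) π := by
  intro i j
  have h := hP i j
  have h2 : π i * (1 : Matrix V V ℝ) i j = π j * (1 : Matrix V V ℝ) j i := by
    by_cases hij : i = j
    · subst hij; rfl
    · simp [hij, Ne.symm hij]
  simp only [_root_.dLazy, Matrix.add_apply, Matrix.smul_apply, smul_eq_mul]
  linear_combination δ * h2 + (1 - δ) * h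

/-- The bound `P f ≤ ρ f` passes to lazy versions. -/
theorem dLazy_sum_le {P : Matrix V V ℝ} {δ : ℝ} (h1 : δ < 1) {f : V → ℝ} {ρ : ℝ} {v : V}
    (h : ∑ u, P v u * f u ≤ ρ * f v) :
    ∑ u, dLazy δ P v u * f u ≤ (δ + (1 - δ) * ρ) * f v := by
  rw [dLazy_apply_sum]
  nlinarith

theorem dLazy_pow_hold {P : Matrix V V ℝ} (hP : IsStoch P) {δ : ℝ} (h0 : 0 < δ) (h1 : δ < 1)
    (t : ℕ) (x : V) : δ ^ t ≤ (dLazy δ P ^ t) x x := by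
  have hM := hP.dLazy h0 h1
  induction t with
  | zero => simp
  | succ t ih =>
    refine le_trans ?_ (pow_add_ge hM t 1 x x x)
    rw [pow_succ, pow_one]
    refine mul_le_mul ih ?_ h0.le ((hM.pow t).1 _ _)
    simp only [dLazy, Matrix.add_apply, Matrix.smul_apply, smul_eq_mul, Matrix.one_apply_eq]
    nlinarith [hP.1 x x]

theorem dLazy_apply_ge {P : Matrix V V ℝ} {δ : ℝ} (h0 : 0 < δ) (x y : V) :
    (1 - δ) * P x y ≤ dLazy δ P x y := by
  have h2 : (0 : ℝ) ≤ (1 : Matrix V V ℝ) x y := by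
    rw [Matrix.one_apply]; split_ifs <;> norm_num
  simp only [dLazy, Matrix.add_apply, Matrix.smul_apply, smul_eq_mul]
  nlinarith

end Generic

section Reindex

variable {U : Type} [Fintype U] [DecidableEq U]

theorem submatrix_pow (M : Matrix V V ℝ) (e : U ≃ V) (t : ℕ) :
    M.submatrix e e ^ t = (M ^ t).submatrix e e := by
  induction t with
  | zero => simp
  | succ t ih => rw [pow_succ, ih, pow_succ, Matrix.submatrix_mul_equiv]

theorem dSep_submatrix (M : Matrix V V ℝ) (π : V → ℝ) (e : U ≃ V) (t : ℕ) :
    dSep (M.submatrix e e) (π ∘ e) t = dSep M π t := by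
  unfold dSep
  rw [submatrix_pow]
  congr 1
  exact e.iInf_congr (g := fun x => ⨅ y, (M ^ t) x y / π y) fun x =>
    (e.iInf_congr (g := fun y => (M ^ t) (e x) y / π y) fun y => rfl).symm ▸ rfl

theorem sepTime_submatrix (M : Matrix V V ℝ) (π : V → ℝ) (e : U ≃ V) (ε : ℝ) :
    sepTime (M.submatrix e e) (π ∘ e) ε = sepTime M π ε := by
  simp only [sepTime, dSep_submatrix]

theorem dLazy_submatrix (M : Matrix V V ℝ) (e : U ≃ V) (δ : ℝ) :
    dLazy δ (M.submatrix e e) = (dLazy δ M).submatrix e e := by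
  ext i j
  simp [dLazy, Matrix.one_apply]

end Reindex

/-- Parameters of a reversible network made of three paths of length `m` glued at a common root.
The conductances decay geometrically (with ratio `r`) away from the root, the far ends of the
first two paths are joined by an edge of conductance `X`, and the vertex at height `k` of the
third path is joined to the root. -/
structure Net where
  m : ℕ
  k : ℕ
  r : ℝ
  τ : ℝ
  X : ℝ
  hk : 2 ≤ k
  hkm : k < m
  hr0 : 0 < r
  hr : r ≤ 1 / 4
  hτ : 0 < τ
  hX0 : 0 < X
  hX : X ≤ τ * r ^ (m - 1) * (2 * r / (1 - r))

namespace Net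

/-- The vertices: the root `none`, and `some (b, i)` at height `i + 1` on the branch `b`. -/
abbrev Vx (N : Net) : Type := Option (Fin 3 × Fin N.m)

variable (N : Net)

/-- The conductance of the loop at the end of branch `b`. -/
def loop (b : Fin 3) : ℝ :=
  N.τ * N.r ^ (N.m - 1) * (2 * N.r / (1 - N.r)) - if b = 2 then 0 else N.X

/-- The conductance between the root and another vertex. -/
def att (b : Fin 3) (i : ℕ) : ℝ :=
  (if i = 0 then N.τ else 0) + if b = 2 then (if i = N.k - 1 then N.τ * N.r ^ (N.k - 1) else 0)
    else 0

/-- The conductances. -/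
def w : N.Vx → N.Vx → ℝ
  | none, none => 1
  | none, some y => N.att y.1 y.2
  | some x, none => N.att x.1 x.2
  | some x, some y =>
    if x.1 = y.1 then
      (if (y.2 : ℕ) = x.2 + 1 then N.τ * N.r ^ (y.2 : ℕ) else 0) +
      ((if (x.2 : ℕ) = y.2 + 1 then N.τ * N.r ^ (x.2 : ℕ) else 0) +
      if (y.2 : ℕ) = x.2 then (if (x.2 : ℕ) = N.m - 1 then N.loop x.1 else 0) else 0)
    else if x.1 ≠ 2 ∧ y.1 ≠ 2 ∧ (x.2 : ℕ) = N.m - 1 then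
      (if (y.2 : ℕ) = N.m - 1 then N.X else 0) else 0

/-- The total conductance at a vertex. -/
def c (v : N.Vx) : ℝ := ∑ u, N.w v u

/-- The total conductance. -/
def W : ℝ := ∑ v, N.c v

/-- The transition matrix of the network. -/
def P : Matrix N.Vx N.Vx ℝ := Matrix.of fun v u => N.w v u / N.c v

/-- The stationary distribution of the network. -/
def sta (v : N.Vx) : ℝ := N.c v / N.W

/-- The function on the vertices with value `a` at the root and `φ b h` at height `h` on the
branch `b`. -/
def lift (φ : Fin 3 → ℕ → ℝ) (a : ℝ) : N.Vx → ℝ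
  | none => a
  | some x => φ x.1 (x.2 + 1)

/-- The drift towards the root. -/
def v : ℝ := (1 - N.r) / (1 + N.r)

/-- The probability of crossing between the ends of the first two branches. -/
def cross : ℝ := N.X / (N.τ * N.r ^ (N.m - 1)) * N.v

theorem m_pos : 0 < N.m := by have := N.hkm; omega

theorem w_comm (x y : N.Vx) : N.w x y = N.w y x := by
  rcases x with _ | ⟨b, i⟩ <;> rcases y with _ | ⟨b', j⟩ <;> simp only [w]
  by_cases hb : b = b'
  · subst hb
    simp only [if_true]
    by_cases hij : i = j
    · subst hij; rfl
    · have : (i : ℕ) ≠ j := fun h => hij (Fin.ext h)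
      simp only [this, this.symm, if_false, add_zero]
      ring
  · simp only [hb, Ne.symm hb, if_false]
    by_cases h1 : b = 2 <;> by_cases h2 : b' = 2 <;> by_cases h3 : (i : ℕ) = N.m - 1 <;>
      by_cases h4 : (j : ℕ) = N.m - 1 <;> simp [h1, h2, h3, h4]

theorem loop_nonneg (b : Fin 3) : 0 ≤ N.loop b := by
  have h1 := N.hX
  have h2 := N.hX0
  unfold loop
  split_ifs <;> linarith

theorem att_nonneg (b : Fin 3) (i : ℕ) : 0 ≤ N.att b i := by
  have h1 := N.hτ
  have h2 := N.hr0
  unfold att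
  split_ifs <;> positivity

theorem w_nonneg (x y : N.Vx) : 0 ≤ N.w x y := by
  have h1 := N.hτ
  have h2 := N.hr0
  have h3 := N.hX0
  rcases x with _ | ⟨b, i⟩ <;> rcases y with _ | ⟨b', j⟩ <;> simp only [w]
  · norm_num
  · exact N.att_nonneg _ _
  · exact N.att_nonneg _ _
  · have h4 := N.loop_nonneg b
    split_ifs <;> positivity

theorem sum_fin_ite (m a : ℕ) (F : ℕ → ℝ) :
    ∑ j : Fin m, (if (j : ℕ) = a then F j else 0) = if a < m then F a else 0 := by
  rw [Fin.sum_univ_eq_sum_range (fun j => if j = a then F j else 0) m]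
  simp [Finset.sum_ite_eq']

theorem sum_w_root (φ : Fin 3 → ℕ → ℝ) (a : ℝ) :
    ∑ u, N.w none u * N.lift φ a u =
      a + N.τ * (φ 0 1 + φ 1 1 + φ 2 1) + N.τ * N.r ^ (N.k - 1) * φ 2 N.k := by
  have hk := N.hk
  have hkm := N.hkm
  have e : N.k - 1 + 1 = N.k := by omega
  have h1 : N.k - 1 < N.m := by omega
  rw [Fintype.sum_option, Fintype.sum_prod_type, Fin.sum_univ_three]
  simp only [w, lift, att, add_mul, ite_mul, zero_mul, sum_add_distrib, one_mul,
    show (0 : Fin 3) ≠ 2 by decide, show (1 : Fin 3) ≠ 2 by decide, if_false, if_true,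
    sum_const_zero]
  rw [sum_fin_ite N.m 0 (fun j => N.τ * φ 0 (j + 1)), sum_fin_ite N.m 0 (fun j => N.τ * φ 1 (j + 1)),
    sum_fin_ite N.m 0 (fun j => N.τ * φ 2 (j + 1)),
    sum_fin_ite N.m (N.k - 1) (fun j => N.τ * N.r ^ (N.k - 1) * φ 2 (j + 1))]
  simp only [N.m_pos, h1, if_true, e, zero_add]
  ring

theorem sum_branch (b : Fin 3) (i : Fin N.m) (φ : ℕ → ℝ) :
    ∑ j : Fin N.m, ((if (j : ℕ) = i + 1 then N.τ * N.r ^ (j : ℕ) else 0) +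
      ((if (i : ℕ) = j + 1 then N.τ * N.r ^ (i : ℕ) else 0) +
      if (j : ℕ) = i then (if (i : ℕ) = N.m - 1 then N.loop b else 0) else 0)) * φ (j + 1) =
    (if (i : ℕ) + 1 < N.m then N.τ * N.r ^ ((i : ℕ) + 1) * φ (i + 2) else 0) +
      ((if (i : ℕ) = 0 then 0 else N.τ * N.r ^ (i : ℕ) * φ i) +
      if (i : ℕ) = N.m - 1 then N.loop b * φ N.m else 0) := by
  have hm := N.m_pos
  simp only [add_mul, ite_mul, zero_mul, sum_add_distrib]
  rw [sum_fin_ite N.m (i + 1) (fun j => N.τ * N.r ^ j * φ (j + 1)),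
    sum_fin_ite N.m i (fun j => if (i : ℕ) = N.m - 1 then N.loop b * φ (j + 1) else 0)]
  congr 1
  congr 1
  · by_cases h : (i : ℕ) = 0
    · simp [h]
    · have : ∀ j : Fin N.m, ((i : ℕ) = j + 1) ↔ ((j : ℕ) = i - 1) := fun j => by omega
      simp only [this, h, if_false]
      rw [sum_fin_ite N.m (i - 1) (fun j => N.τ * N.r ^ (i : ℕ) * φ (j + 1)),
        if_pos (by have := i.2; omega), show (i : ℕ) - 1 + 1 = i by omega]
  · rw [if_pos i.2]
    by_cases h : (i : ℕ) = N.m - 1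
    · rw [if_pos h, if_pos h, show (i : ℕ) + 1 = N.m by omega]
    · rw [if_neg h, if_neg h]

/-- The value at height `N.m` on the branch across. -/
def across (φ : Fin 3 → ℕ → ℝ) (b : Fin 3) : ℝ :=
  if b = 0 then φ 1 N.m - φ 0 N.m else if b = 1 then φ 0 N.m - φ 1 N.m else 0

theorem sum_w_branch (φ : Fin 3 → ℕ → ℝ) (a : ℝ) (hφ : ∀ b, φ b 0 = a) (b : Fin 3)
    (i : Fin N.m) :
    ∑ u, N.w (some (b, i)) u * N.lift φ a u =
      (if b = 2 then (if (i : ℕ) = N.k - 1 then N.τ * N.r ^ (N.k - 1) * a else 0) else 0) +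
      (N.τ * N.r ^ (i : ℕ) * φ b i + if (i : ℕ) + 1 < N.m
        then N.τ * N.r ^ ((i : ℕ) + 1) * φ b (i + 2)
        else N.τ * N.r ^ (N.m - 1) * (2 * N.r / (1 - N.r)) * φ b N.m + N.X * N.across φ b) := by
  have hm := N.m_pos
  have hatt : N.τ * N.r ^ (i : ℕ) * φ b i =
      (if (i : ℕ) = 0 then N.τ else 0) * a +
      if (i : ℕ) = 0 then 0 else N.τ * N.r ^ (i : ℕ) * φ b i := by
    by_cases h : (i : ℕ) = 0 <;> simp [h, hφ]
  have hsame : ∑ j : Fin N.m, N.w (some (b, i)) (some (b, j)) * N.lift φ a (some (b, j)) =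
      (if (i : ℕ) + 1 < N.m then N.τ * N.r ^ ((i : ℕ) + 1) * φ b (i + 2) else 0) +
      ((if (i : ℕ) = 0 then 0 else N.τ * N.r ^ (i : ℕ) * φ b i) +
      if (i : ℕ) = N.m - 1 then N.loop b * φ b N.m else 0) := by
    rw [← sum_branch]
    simp only [w, lift, if_true]
  have hdiff : ∀ b', b ≠ b' →
      ∑ j : Fin N.m, N.w (some (b, i)) (some (b', j)) * N.lift φ a (some (b', j)) =
      if b ≠ 2 ∧ b' ≠ 2 ∧ (i : ℕ) = N.m - 1 then N.X * φ b' N.m else 0 := by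
    intro b' hb
    simp only [w, lift, if_neg hb]
    by_cases h : b ≠ 2 ∧ b' ≠ 2 ∧ (i : ℕ) = N.m - 1
    · simp only [if_pos h, ite_mul, zero_mul]
      rw [sum_fin_ite N.m (N.m - 1) (fun j => N.X * φ b' (j + 1)), if_pos (by omega),
        show N.m - 1 + 1 = N.m by omega]
    · simp only [if_neg h, zero_mul, sum_const_zero]
  have hlt : (i : ℕ) + 1 < N.m ↔ ¬ (i : ℕ) = N.m - 1 := by have := i.2; omega
  rw [Fintype.sum_option, Fintype.sum_prod_type, Fin.sum_univ_three, hatt]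
  have hroot : N.w (some (b, i)) none * N.lift φ a none = N.att b i * a := rfl
  rw [hroot]
  obtain rfl | rfl | rfl : b = 0 ∨ b = 1 ∨ b = 2 := by omega
  · rw [hsame, hdiff 1 (by decide), hdiff 2 (by decide)]
    simp only [att, across, loop, hlt, Fin.isValue, Fin.reduceEq, ne_eq, if_true, if_false,
      not_true, not_false_iff, true_and, false_and]
    by_cases ht : (i : ℕ) = N.m - 1 <;>
      simp only [ht, if_true, if_false, not_true, not_false_iff] <;> ring
  · rw [hsame, hdiff 0 (by decide), hdiff 2 (by decide)]
    simp only [att, across, loop, hlt, Fin.isValue, Fin.reduceEq, ne_eq, if_true, if_false,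
      not_true, not_false_iff, true_and, false_and]
    by_cases ht : (i : ℕ) = N.m - 1 <;>
      simp only [ht, if_true, if_false, not_true, not_false_iff] <;> ring
  · rw [hsame, hdiff 0 (by decide), hdiff 1 (by decide)]
    simp only [att, across, loop, hlt, Fin.isValue, Fin.reduceEq, ne_eq, if_true, if_false,
      not_true, not_false_iff, true_and, false_and]
    by_cases ht : (i : ℕ) = N.m - 1 <;>
      simp only [ht, if_true, if_false, not_true, not_false_iff] <;> ring_nf <;>
      split_ifs <;> ring

end Net

namespace Net

variable (N : Net)

theorem c_eq_sum_lift (x : N.Vx) : N.c x = ∑ u, N.w x u * N.lift (fun _ _ => 1) 1 u := by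
  refine sum_congr rfl fun u _ => ?_
  cases u <;> simp [lift]

theorem across_const (a : ℝ) (b : Fin 3) : N.across (fun _ _ => a) b = 0 := by
  unfold across; split_ifs <;> simp

theorem c_root : N.c none = 1 + 3 * N.τ + N.τ * N.r ^ (N.k - 1) := by
  rw [c_eq_sum_lift, sum_w_root]; ring

theorem c_inner {b : Fin 3} {i : Fin N.m} (hi : (i : ℕ) + 1 < N.m)
    (h : ¬ (b = 2 ∧ (i : ℕ) = N.k - 1)) :
    N.c (some (b, i)) = N.τ * N.r ^ (i : ℕ) * (1 + N.r) := by
  rw [c_eq_sum_lift, sum_w_branch _ _ _ (fun _ => rfl), if_pos hi, ← ite_and, if_neg h]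
  ring

theorem c_chord {i : Fin N.m} (h : (i : ℕ) = N.k - 1) :
    N.c (some (2, i)) = N.τ * N.r ^ (i : ℕ) * (2 + N.r) := by
  have := N.hk
  have := N.hkm
  rw [c_eq_sum_lift, sum_w_branch _ _ _ (fun _ => rfl), if_pos h,
    if_pos (by omega : (i : ℕ) + 1 < N.m), if_pos rfl, ← h]
  ring

theorem c_top {b : Fin 3} {i : Fin N.m} (hi : (i : ℕ) + 1 = N.m) :
    N.c (some (b, i)) = N.τ * N.r ^ (N.m - 1) * ((1 + N.r) / (1 - N.r)) := by
  have h1 := N.hk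
  have h2 := N.hkm
  have h3 : 1 - N.r ≠ 0 := by have := N.hr; linarith
  rw [c_eq_sum_lift, sum_w_branch _ _ _ (fun _ => rfl), if_neg (by omega : ¬ (i : ℕ) + 1 < N.m),
    across_const, ← ite_and, if_neg (by omega), show (i : ℕ) = N.m - 1 by omega]
  field_simp
  ring

theorem c_pos (x : N.Vx) : 0 < N.c x := by
  have h1 := N.hτ
  have h2 := N.hr0
  have h3 : 0 < 1 - N.r := by have := N.hr; linarith
  rcases x with _ | ⟨b, i⟩
  · rw [c_root]; positivity
  · by_cases hi : (i : ℕ) + 1 < N.m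
    · by_cases h : b = 2 ∧ (i : ℕ) = N.k - 1
      · obtain ⟨rfl, h⟩ := h
        rw [N.c_chord h]; positivity
      · rw [N.c_inner hi h]; positivity
    · rw [N.c_top (by omega)]; positivity

theorem c_le (b : Fin 3) (i : Fin N.m) : N.c (some (b, i)) ≤ 4 * N.τ := by
  have h1 := N.hτ
  have h2 := N.hr0
  have h4 := N.hr
  have h3 : 0 < 1 - N.r := by linarith
  have hp : ∀ n : ℕ, N.τ * N.r ^ n ≤ N.τ := fun n =>
    mul_le_of_le_one_right h1.le (pow_le_one₀ h2.le (by linarith))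
  have hq : ∀ n : ℕ, 0 ≤ N.τ * N.r ^ n := fun n => by positivity
  have key : ∀ (n : ℕ) (a : ℝ), 0 ≤ a → a ≤ 4 → N.τ * N.r ^ n * a ≤ 4 * N.τ := by
    intro n a ha ha'
    nlinarith [hp n, hq n, mul_le_mul (hp n) ha' ha h1.le]
  by_cases hi : (i : ℕ) + 1 < N.m
  · by_cases h : b = 2 ∧ (i : ℕ) = N.k - 1
    · obtain ⟨rfl, h⟩ := h
      rw [N.c_chord h]
      exact key _ _ (by linarith) (by linarith)
    · rw [N.c_inner hi h]
      exact key _ _ (by linarith) (by linarith)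
  · rw [N.c_top (by omega)]
    refine key _ _ (by positivity) ?_
    rw [div_le_iff₀ h3]
    linarith

theorem W_eq : N.W = N.c none + ∑ x : Fin 3 × Fin N.m, N.c (some x) := Fintype.sum_option _

theorem W_pos : 0 < N.W := sum_pos (fun x _ => N.c_pos x) ⟨none, mem_univ _⟩

theorem W_le : N.W ≤ 1 + 16 * N.m * N.τ := by
  have hm : (1 : ℝ) ≤ N.m := by exact_mod_cast N.m_pos
  have h1 := N.hτ
  have h2 : N.r ^ (N.k - 1) ≤ 1 := pow_le_one₀ N.hr0.le (by linarith [N.hr])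
  have h3 : ∑ x : Fin 3 × Fin N.m, N.c (some x) ≤ ∑ _x : Fin 3 × Fin N.m, 4 * N.τ :=
    sum_le_sum fun x _ => N.c_le x.1 x.2
  simp only [sum_const, card_univ, Fintype.card_prod, Fintype.card_fin, nsmul_eq_mul] at h3
  push_cast at h3
  rw [W_eq, c_root]
  nlinarith [mul_le_mul_of_nonneg_left h2 h1.le]

theorem c_root_ge : 1 ≤ N.c none := by
  have h1 := N.hτ
  have h2 := N.hr0
  rw [c_root]
  have : 0 ≤ N.τ * N.r ^ (N.k - 1) := by positivity
  linarith

theorem W_ge : 1 ≤ N.W := by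
  rw [W_eq]
  have h3 : 0 ≤ ∑ x : Fin 3 × Fin N.m, N.c (some x) := sum_nonneg fun x _ => (N.c_pos _).le
  linarith [N.c_root_ge]

theorem isProb_sta : IsProb N.sta := by
  refine ⟨fun x => div_pos (N.c_pos x) N.W_pos, ?_⟩
  simp only [sta, ← sum_div]
  exact div_self N.W_pos.ne'

theorem isStoch_P : IsStoch N.P := by
  refine ⟨fun x y => div_nonneg (N.w_nonneg x y) (N.c_pos x).le, fun x => ?_⟩
  simp only [P, Matrix.of_apply, ← sum_div]
  exact div_self (N.c_pos x).ne'

theorem rev_P : Rev N.P N.sta := by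
  intro x y
  have hx := (N.c_pos x).ne'
  have hy := (N.c_pos y).ne'
  have hW := N.W_pos.ne'
  simp only [P, sta, Matrix.of_apply, N.w_comm x y]
  field_simp

theorem sum_P (x : N.Vx) (f : N.Vx → ℝ) : ∑ u, N.P x u * f u = (∑ u, N.w x u * f u) / N.c x := by
  rw [sum_div]
  refine sum_congr rfl fun u _ => ?_
  simp only [P, Matrix.of_apply]
  ring

theorem P_root (φ : Fin 3 → ℕ → ℝ) (a : ℝ) :
    ∑ u, N.P none u * N.lift φ a u =
      (a + N.τ * (φ 0 1 + φ 1 1 + φ 2 1) + N.τ * N.r ^ (N.k - 1) * φ 2 N.k) / N.c none := by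
  rw [sum_P, sum_w_root]

theorem P_inner (φ : Fin 3 → ℕ → ℝ) (a : ℝ) (hφ : ∀ b, φ b 0 = a) {b : Fin 3} {i : Fin N.m}
    (hi : (i : ℕ) + 1 < N.m) (h : ¬ (b = 2 ∧ (i : ℕ) = N.k - 1)) :
    ∑ u, N.P (some (b, i)) u * N.lift φ a u = (φ b i + N.r * φ b (i + 2)) / (1 + N.r) := by
  have h1 := N.hτ.ne'
  have h2 := N.hr0
  rw [sum_P, sum_w_branch _ _ _ hφ, if_pos hi, ← ite_and, if_neg h, N.c_inner hi h]
  field_simp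
  ring

theorem P_chord (φ : Fin 3 → ℕ → ℝ) (a : ℝ) (hφ : ∀ b, φ b 0 = a) {i : Fin N.m}
    (h : (i : ℕ) = N.k - 1) :
    ∑ u, N.P (some (2, i)) u * N.lift φ a u =
      (φ 2 i + N.r * φ 2 (i + 2) + a) / (2 + N.r) := by
  have h1 := N.hτ.ne'
  have h2 := N.hr0
  have := N.hk
  have := N.hkm
  rw [sum_P, sum_w_branch _ _ _ hφ, if_pos h,
    if_pos (by omega : (i : ℕ) + 1 < N.m), if_pos rfl, N.c_chord h, ← h]
  field_simp
  ring

theorem P_top (φ : Fin 3 → ℕ → ℝ) (a : ℝ) (hφ : ∀ b, φ b 0 = a) {b : Fin 3} {i : Fin N.m}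
    (hi : (i : ℕ) + 1 = N.m) :
    ∑ u, N.P (some (b, i)) u * N.lift φ a u =
      N.v * φ b i + (1 - N.v) * φ b N.m + N.cross * N.across φ b := by
  have h1 := N.hτ.ne'
  have h2 := N.hr0
  have h4 := N.hk
  have h5 := N.hkm
  have h3 : 1 - N.r ≠ 0 := by have := N.hr; linarith
  have h6 : N.r ^ (N.m - 1) ≠ 0 := by positivity
  have h7 : 1 + N.r ≠ 0 := by positivity
  rw [sum_P, sum_w_branch _ _ _ hφ, if_neg (by omega : ¬ (i : ℕ) + 1 < N.m), N.c_top hi,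
    ← ite_and, if_neg (by omega), v, cross, v]
  generalize φ b i = u
  rw [show (i : ℕ) = N.m - 1 by omega]
  field_simp
  ring

theorem v_pos : 0 < N.v := div_pos (by linarith [N.hr]) (by linarith [N.hr0])

theorem v_lt_one : N.v < 1 := by
  rw [v, div_lt_one (by linarith [N.hr0])]; linarith [N.hr0]

theorem one_sub_v_le : 1 - N.v ≤ 2 * N.r := by
  have h := N.hr0
  have : 1 - N.v = 2 * N.r / (1 + N.r) := by unfold v; field_simp; ring
  rw [this, div_le_iff₀ (by linarith)]
  nlinarith

theorem half_le_v : 1 / 2 ≤ N.v := by linarith [N.one_sub_v_le, N.hr]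

theorem cross_pos : 0 < N.cross := by
  have h1 := N.hτ
  have h2 := N.hr0
  have h3 := N.hX0
  have h4 := N.v_pos
  unfold cross; positivity

theorem cross_le : N.cross ≤ 1 - N.v := by
  have h1 := N.hτ
  have h2 := N.hr0
  have h3 := N.hX
  have h4 := N.v_pos
  have h5 : 0 < 1 - N.r := by have := N.hr; linarith
  have h6 : N.X / (N.τ * N.r ^ (N.m - 1)) ≤ 2 * N.r / (1 - N.r) := by
    rw [div_le_iff₀ (by positivity)]; linarith
  have : 1 - N.v = 2 * N.r / (1 - N.r) * N.v := by unfold v; field_simp; ring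
  rw [this]
  exact mul_le_mul_of_nonneg_right h6 h4.le

/-- The vertex at the end of the branch `b`. -/
def top (b : Fin 3) : N.Vx := some (b, ⟨N.m - 1, by have := N.m_pos; omega⟩)

theorem P_up {b : Fin 3} {i : ℕ} (hi : i + 1 < N.m) (hb : b ≠ 2) :
    N.P (some (b, ⟨i, by omega⟩)) (some (b, ⟨i + 1, hi⟩)) = N.r / (1 + N.r) := by
  have h1 := N.hτ.ne'
  have h2 := N.hr0
  rw [P, Matrix.of_apply, N.c_inner (i := ⟨i, by omega⟩) hi (by tauto)]
  simp only [w, if_true]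
  rw [if_neg (by omega), if_neg (by omega)]
  field_simp
  ring

theorem P_cross {b b' : Fin 3} (hb : b ≠ 2) (hb' : b' ≠ 2) (h : b ≠ b') :
    N.P (N.top b) (N.top b') = N.cross := by
  have h1 := N.hτ.ne'
  have h2 := N.hr0
  have h3 : 1 - N.r ≠ 0 := by have := N.hr; linarith
  have h4 := N.m_pos
  rw [P, Matrix.of_apply, top, top, N.c_top (by simp; omega)]
  simp only [w, if_neg h, hb, hb', ne_eq, not_false_iff, true_and, if_true, cross, v]
  field_simp

theorem sta_top (b : Fin 3) : N.sta (N.top b) = N.τ * N.r ^ (N.m - 1) / N.v / N.W := by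
  have h3 : 1 - N.r ≠ 0 := by have := N.hr; linarith
  have h2 := N.hr0
  have h4 := N.m_pos
  rw [sta, top, N.c_top (by simp; omega), v]
  field_simp

theorem w_root_some_pos {b : Fin 3} (h : 0 < N.m) : 0 < N.P (some (b, ⟨0, h⟩)) none := by
  refine div_pos ?_ (N.c_pos _)
  simp only [w, att, if_true]
  have h1 := N.hτ
  have h2 := N.hr0
  split_ifs <;> positivity

theorem P_down_pos {b : Fin 3} {i : ℕ} (hi : i + 1 < N.m) :
    0 < N.P (some (b, ⟨i + 1, hi⟩)) (some (b, ⟨i, by omega⟩)) := by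
  refine div_pos ?_ (N.c_pos _)
  simp only [w, if_true]
  have h1 := N.hτ
  have h2 := N.hr0
  rw [if_neg (by omega), if_neg (by omega)]
  positivity

theorem irred_P : Irred N.P := by
  have hP := N.isStoch_P
  have h1 : ∀ b i, ∀ hi : i < N.m, ∃ t, 0 < (N.P ^ t) (some (b, ⟨i, hi⟩)) none := by
    intro b i
    induction i with
    | zero => exact fun hi => ⟨1, by rw [pow_one]; exact N.w_root_some_pos hi⟩
    | succ i ih =>
      intro hi
      obtain ⟨t, ht⟩ := ih (by omega)
      refine ⟨1 + t, lt_of_lt_of_le ?_ (pow_add_ge hP 1 t _ (some (b, ⟨i, by omega⟩)) _)⟩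
      rw [pow_one]
      exact mul_pos (N.P_down_pos hi) ht
  have h2 : ∀ x, ∃ t, 0 < (N.P ^ t) x none := by
    rintro (_ | ⟨b, i⟩)
    · exact ⟨0, by simp⟩
    · exact h1 b i i.2
  intro x y
  obtain ⟨s, hs⟩ := h2 x
  obtain ⟨t, ht⟩ := h2 y
  refine ⟨s + t, lt_of_lt_of_le (mul_pos hs ?_) (pow_add_ge hP s t x none y)⟩
  have h3 := N.rev_P.pow t y none
  have h4 := N.isProb_sta.1 y
  have h5 := N.isProb_sta.1 none
  have h6 : 0 < N.sta none * (N.P ^ t) none y := by rw [← h3]; positivity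
  exact (mul_pos_iff_of_pos_left h5).1 h6

end Net

namespace Net

variable (N : Net)

/-- The multiplicative drift of `z ^ h`, where `h` is the height. -/
def drift (z : ℝ) : ℝ := (z⁻¹ + N.r * z) / (1 + N.r)

variable {N}

theorem top_drift {z : ℝ} (hz : 0 < z) : N.v * z⁻¹ + (1 - N.v) ≤ N.drift z := by
  have h0 := N.hr0
  have h1 : (0 : ℝ) < 1 + N.r := by linarith
  have h2 : N.v * z⁻¹ + (1 - N.v) = ((1 - N.r) * z⁻¹ + 2 * N.r) / (1 + N.r) := by
    unfold v; field_simp; ring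
  have h3 : z * z⁻¹ = 1 := mul_inv_cancel₀ hz.ne'
  have h4 : 2 ≤ z + z⁻¹ := by nlinarith [sq_nonneg (z - z⁻¹), inv_pos.2 hz]
  rw [h2, drift]
  exact div_le_div_of_nonneg_right (by nlinarith) h1.le

theorem drift_pos {z : ℝ} (hz : 0 < z) : 0 < N.drift z := by
  have h0 := N.hr0
  unfold drift; positivity

theorem one_le_drift_inv {z : ℝ} (hz : 1 ≤ z) : 1 ≤ N.drift z⁻¹ := by
  have h0 := N.hr0
  have h1 := N.hr
  have h3 : z * z⁻¹ = 1 := mul_inv_cancel₀ (by positivity)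
  have h4 : z⁻¹ ≤ 1 := inv_le_one_of_one_le₀ hz
  rw [drift, inv_inv, le_div_iff₀ (by linarith)]
  nlinarith

/-- A geometric function of the height, forced to be `0` at the root, contracts. -/
theorem geom_le {z : ℝ} (hz : 0 < z) (φ : Fin 3 → ℕ → ℝ) {b : Fin 3} {i : Fin N.m}
    (h0 : ∀ b, φ b 0 = 0) (hb : ∀ j, φ b j ≤ z ^ j) (hb' : φ b (i + 1) = z ^ ((i : ℕ) + 1))
    (hacross : N.across φ b ≤ 0) :
    ∑ u, N.P (some (b, i)) u * N.lift φ 0 u ≤ N.drift z * N.lift φ 0 (some (b, i)) := by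
  have hr := N.hr0
  have e1 : N.drift z * N.lift φ 0 (some (b, i)) =
      (z ^ (i : ℕ) + N.r * z ^ ((i : ℕ) + 2)) / (1 + N.r) := by
    simp only [lift, drift, hb']
    field_simp
    ring
  by_cases hi : (i : ℕ) + 1 < N.m
  · rw [e1]
    by_cases h : b = 2 ∧ (i : ℕ) = N.k - 1
    · obtain ⟨rfl, h⟩ := h
      rw [N.P_chord φ 0 h0 h, add_zero]
      refine le_trans (div_le_div_of_nonneg_right (add_le_add (hb i)
        (mul_le_mul_of_nonneg_left (hb _) hr.le)) (by linarith)) ?_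
      exact div_le_div_of_nonneg_left (by positivity) (by linarith) (by linarith)
    · rw [N.P_inner φ 0 h0 hi h]
      exact div_le_div_of_nonneg_right (add_le_add (hb i)
        (mul_le_mul_of_nonneg_left (hb _) hr.le)) (by linarith)
  · have hi' : (i : ℕ) + 1 = N.m := by omega
    rw [N.P_top φ 0 h0 hi']
    have h1 : N.v * φ b i + (1 - N.v) * φ b N.m + N.cross * N.across φ b ≤
        N.v * z ^ (i : ℕ) + (1 - N.v) * z ^ ((i : ℕ) + 1) := by
      have h2 := mul_le_mul_of_nonneg_left (hb i) N.v_pos.le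
      have h3 := mul_nonneg N.cross_pos.le (neg_nonneg.2 hacross)
      rw [show φ b N.m = z ^ ((i : ℕ) + 1) by rw [← hb', hi']]
      nlinarith [N.cross_pos]
    refine h1.trans ?_
    have h4 := mul_le_mul_of_nonneg_right (N.top_drift hz) (pow_pos hz ((i : ℕ) + 1)).le
    have e2 : (N.v * z⁻¹ + (1 - N.v)) * z ^ ((i : ℕ) + 1) =
        N.v * z ^ (i : ℕ) + (1 - N.v) * z ^ ((i : ℕ) + 1) := by
      field_simp
      ring
    rw [← e2]
    simpa only [lift, hb'] using h4

/-- An upper bound for the probability of being off the root. -/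
theorem off_root_le {δ z : ℝ} (hδ0 : 0 < δ) (hδ1 : δ < 1) (hz : 1 ≤ z) (hrz : N.r * z ≤ 1)
    (φ : Fin 3 → ℕ → ℝ) (h1 : ∀ b j, φ b j ≤ 1)
    (hφ : ∀ b i, ∑ u, N.P (some (b, i)) u * N.lift φ 0 u ≤ N.lift φ 0 (some (b, i)))
    {K : ℝ} (hK0 : 0 ≤ K) (hK1 : K ≤ 1) (hK : ∀ b j, 1 ≤ j → 1 ≤ φ b j + K * z ^ j)
    (t : ℕ) (x : N.Vx) :
    1 - (dLazy δ N.P ^ t) x none ≤ N.lift φ 0 x +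
      K * (δ + (1 - δ) * N.drift z) ^ t * N.lift (fun _ j => if j = 0 then 0 else z ^ j) 0 x +
      8 * N.τ * z * t := by
  have hr := N.hr0
  have hτ := N.hτ
  have hM := N.isStoch_P.dLazy hδ0 hδ1
  have hz0 : 0 < z := by linarith
  set ρ := δ + (1 - δ) * N.drift z with hρ
  set F : Fin 3 → ℕ → ℝ := fun _ j => if j = 0 then 0 else z ^ j with hF
  have hd : N.drift z ≤ 1 := by
    have h3 : z * z⁻¹ = 1 := mul_inv_cancel₀ hz0.ne'
    have h4 : z⁻¹ ≤ 1 := inv_le_one_of_one_le₀ hz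
    rw [drift, div_le_one (by linarith)]
    nlinarith
  have hρ1 : ρ ≤ 1 := by nlinarith
  have hρ0 : 0 ≤ ρ := by nlinarith [N.drift_pos hz0]
  have hFr : ∑ u, N.P none u * N.lift F 0 u ≤ 4 * N.τ * z := by
    rw [N.P_root]
    refine div_le_of_le_mul₀ (by linarith [N.c_root_ge]) (by positivity) ?_
    have hk := N.hk
    have e : N.r ^ (N.k - 1) * z ^ N.k = (N.r * z) ^ (N.k - 1) * z := by
      rw [mul_pow, mul_assoc, ← pow_succ, show N.k - 1 + 1 = N.k by omega]
    have h2 : (N.r * z) ^ (N.k - 1) ≤ 1 := pow_le_one₀ (by positivity) hrz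
    have h3 : N.τ * N.r ^ (N.k - 1) * F 2 N.k ≤ N.τ * z := by
      simp only [hF, if_neg (by omega : N.k ≠ 0)]
      rw [mul_assoc, e]
      nlinarith [mul_pos hτ hz0]
    have h4 : ∀ b, F b 1 = z := by simp [hF]
    rw [h4 0]
    nlinarith [N.c_root_ge, mul_pos hτ hz0]
  have hφr : ∑ u, N.P none u * N.lift φ 0 u ≤ 4 * N.τ := by
    rw [N.P_root]
    refine div_le_of_le_mul₀ (by linarith [N.c_root_ge]) (by positivity) ?_
    have h2 : N.r ^ (N.k - 1) ≤ 1 := pow_le_one₀ hr.le (by linarith [N.hr])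
    have h3 : N.τ * N.r ^ (N.k - 1) * φ 2 N.k ≤ N.τ := by
      have h5 : 0 ≤ N.τ * N.r ^ (N.k - 1) := by positivity
      have h6 : N.τ * N.r ^ (N.k - 1) ≤ N.τ := by nlinarith
      nlinarith [h1 2 N.k]
    nlinarith [N.c_root_ge, h1 0 1, h1 1 1, h1 2 1]
  refine le_of_supersolution hM.1 ∅ (fun t x => 1 - (dLazy δ N.P ^ t) x none)
    (fun t x => N.lift φ 0 x + K * ρ ^ t * N.lift F 0 x + 8 * N.τ * z * t) ?_ ?_ ?_ ?_ t x
  · intro t x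
    simp only [mul_sub, mul_one, sum_sub_distrib, hM.2]
    rw [pow_succ', Matrix.mul_apply]
  · rintro (_ | ⟨b, i⟩)
    · simp [lift]
    · have := hK b (i + 1) (by omega)
      simp only [pow_zero, lift, hF, Nat.succ_ne_zero, if_false]
      simp only [Matrix.one_apply, reduceCtorEq, if_false]
      simpa using this
  · intro t x hx
    exact absurd hx (by simp)
  · intro t x _
    have e : ∑ u, dLazy δ N.P x u * (N.lift φ 0 u + K * ρ ^ t * N.lift F 0 u + 8 * N.τ * z * t) =
        ∑ u, dLazy δ N.P x u * N.lift φ 0 u +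
          K * ρ ^ t * ∑ u, dLazy δ N.P x u * N.lift F 0 u + 8 * N.τ * z * t := by
      have : 8 * N.τ * z * t = ∑ u, dLazy δ N.P x u * (8 * N.τ * z * t) := by
        rw [← sum_mul, hM.2, one_mul]
      conv_rhs => rw [this]
      rw [mul_sum, ← sum_add_distrib, ← sum_add_distrib]
      exact sum_congr rfl fun u _ => by ring
    rw [e]
    have hKρ : 0 ≤ K * ρ ^ t := by positivity
    rcases x with _ | ⟨b, i⟩
    · rw [dLazy_apply_sum, dLazy_apply_sum]
      have hKρ1 : K * ρ ^ t ≤ 1 := mul_le_one₀ hK1 (by positivity) (pow_le_one₀ hρ0 hρ1)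
      have e1 : ∀ φ, N.lift φ 0 none = 0 := fun _ => rfl
      rw [e1, e1]
      push_cast
      have h5 : (1 - δ) * ∑ u, N.P none u * N.lift φ 0 u ≤ 4 * N.τ := by nlinarith
      have h6 : (1 - δ) * ∑ u, N.P none u * N.lift F 0 u ≤ 4 * N.τ * z := by
        nlinarith [mul_pos hτ hz0]
      have h7 : K * ρ ^ t * ((1 - δ) * ∑ u, N.P none u * N.lift F 0 u) ≤ 4 * N.τ * z := by
        nlinarith [mul_pos hτ hz0]
      nlinarith
    · have h5 := dLazy_sum_le hδ1 (ρ := 1) (f := N.lift φ 0) (by rw [one_mul]; exact hφ b i)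
      have h6 := dLazy_sum_le hδ1 (geom_le hz0 F (b := b) (i := i) (by simp [hF])
        (by intro j; simp only [hF]; split_ifs; exacts [(pow_pos hz0 _).le, le_rfl])
        (by simp [hF]) (by simp [across, hF]))
      have h7 := mul_le_mul_of_nonneg_left h6 hKρ
      push_cast
      have h8 : 0 < 8 * N.τ * z := by positivity
      rw [pow_succ]
      nlinarith

theorem root_hit {δ z : ℝ} (hδ0 : 0 < δ) (hδ1 : δ < 1) (hz : 1 ≤ z) (hrz : N.r * z ≤ 1)
    (t : ℕ) (b : Fin 3) (i : Fin N.m) :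
    1 - (δ + (1 - δ) * N.drift z) ^ t * z ^ ((i : ℕ) + 1) - 8 * N.τ * z * t ≤
      (dLazy δ N.P ^ t) (some (b, i)) none := by
  have := off_root_le (N := N) hδ0 hδ1 hz hrz (fun _ _ => 0) (by simp)
    (by intro b i; simp [lift]) (K := 1) (by simp) (by simp)
    (by intro b j _; simpa using one_le_pow₀ hz) t (some (b, i))
  simp only [lift, Nat.succ_ne_zero, if_false] at this
  linarith

theorem root_hit_root {δ z : ℝ} (hδ0 : 0 < δ) (hδ1 : δ < 1) (hz : 1 ≤ z) (hrz : N.r * z ≤ 1)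
    (t : ℕ) : 1 - 8 * N.τ * z * t ≤ (dLazy δ N.P ^ t) none none := by
  have := off_root_le (N := N) hδ0 hδ1 hz hrz (fun _ _ => 0) (by simp)
    (by intro b i; simp [lift]) (K := 1) (by simp) (by simp)
    (by intro b j _; simpa using one_le_pow₀ hz) t none
  simp only [lift] at this
  linarith

theorem root_hit_chord {δ z : ℝ} (hδ0 : 0 < δ) (hδ1 : δ < 1) (hz : 1 ≤ z) (hrz : N.r * z ≤ 1)
    (t : ℕ) (i : Fin N.m) (hi : N.k ≤ (i : ℕ) + 1) :
    1 / 2 - (δ + (1 - δ) * N.drift z) ^ t * z ^ ((i : ℕ) + 1 - N.k) - 8 * N.τ * z * t ≤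
      (dLazy δ N.P ^ t) (some (2, i)) none := by
  have hz0 : 0 < z := by linarith
  have hr := N.hr0
  have hk := N.hk
  have hkm := N.hkm
  set φ : Fin 3 → ℕ → ℝ := fun b j => if j = 0 then 0 else if b = 2 ∧ N.k ≤ j then 1 / 2 else 1
    with hφ
  have hle : ∀ b j, φ b j ≤ 1 := by
    intro b j; simp only [hφ]; split_ifs <;> norm_num
  have h0 : ∀ b, φ b 0 = 0 := by simp [hφ]
  have hge : ∀ j, N.k ≤ j → φ 2 j = 1 / 2 := by
    intro j hj
    simp only [hφ]
    rw [if_neg (by omega), if_pos (by simpa using hj)]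
  have hsup : ∀ b i, ∑ u, N.P (some (b, i)) u * N.lift φ 0 u ≤ N.lift φ 0 (some (b, i)) := by
    intro b i
    by_cases hb : b = 2 ∧ N.k ≤ (i : ℕ) + 1
    · obtain ⟨rfl, hb⟩ := hb
      have e : N.lift φ 0 (some (2, i)) = 1 / 2 := hge _ hb
      rw [e]
      by_cases h1 : (i : ℕ) = N.k - 1
      · rw [N.P_chord φ 0 h0 h1, hge (i + 2) (by omega), div_le_iff₀ (by linarith)]
        linarith [hle 2 i]
      · by_cases h2 : (i : ℕ) + 1 < N.m
        · rw [N.P_inner φ 0 h0 h2 (by tauto), hge i (by omega), hge (i + 2) (by omega),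
            div_le_iff₀ (by linarith)]
          linarith
        · rw [N.P_top φ 0 h0 (by omega), hge i (by omega), hge N.m (by omega)]
          simp [across]
          linarith
    · have e : N.lift φ 0 (some (b, i)) = 1 := by
        simp only [lift, hφ, Nat.succ_ne_zero, if_false, if_neg hb]
      have e2 : ∀ b i, N.lift φ 0 (some (b, i)) ≤ 1 := fun b i => hle b (i + 1)
      rw [e, ← N.isStoch_P.2 (some (b, i))]
      refine sum_le_sum fun u _ => mul_le_of_le_one_right (N.isStoch_P.1 _ _) ?_
      rcases u with _ | ⟨b, i⟩
      · simp [lift]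
      · exact e2 b i
  have hK : z⁻¹ ^ N.k ≤ 1 := pow_le_one₀ (by positivity) (inv_le_one_of_one_le₀ hz)
  have := off_root_le (N := N) hδ0 hδ1 hz hrz φ hle hsup (K := z⁻¹ ^ N.k) (by positivity) hK
    (by
      intro b j hj
      simp only [hφ]
      rw [if_neg (by omega)]
      have h3 : 0 < z⁻¹ ^ N.k * z ^ j := by positivity
      split_ifs with h
      · have h4 : z⁻¹ ^ N.k * z ^ j = z ^ (j - N.k) := by
          rw [inv_pow, pow_sub₀ _ hz0.ne' h.2, mul_comm]
        have := one_le_pow₀ (n := j - N.k) hz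
        linarith
      · linarith) t (some (2, i))
  have e1 : N.lift φ 0 (some (2, i)) = 1 / 2 := hge _ hi
  have e2 : z ^ ((i : ℕ) + 1 - N.k) = z⁻¹ ^ N.k * z ^ ((i : ℕ) + 1) := by
    rw [inv_pow, pow_sub₀ _ hz0.ne' hi, mul_comm]
  rw [e1] at this
  simp only [lift, Nat.succ_ne_zero, if_false] at this
  rw [e2]
  linarith

end Net

namespace Net

variable {N : Net}

/-- The profile `z ^ (-h)` on the first two branches. -/
def decay (z : ℝ) : Fin 3 → ℕ → ℝ := fun b j => if b = 2 then 1 else z⁻¹ ^ j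

theorem decay_le_one {z : ℝ} (hz : 1 ≤ z) (b : Fin 3) (j : ℕ) : decay z b j ≤ 1 := by
  unfold decay
  split_ifs
  · exact le_rfl
  · exact pow_le_one₀ (by positivity) (inv_le_one_of_one_le₀ hz)

theorem decay_nonneg {z : ℝ} (hz : 1 ≤ z) (b : Fin 3) (j : ℕ) : 0 ≤ decay z b j := by
  unfold decay
  split_ifs <;> positivity

theorem lift_le {φ : Fin 3 → ℕ → ℝ} {a c : ℝ} (ha : a ≤ c) (hφ : ∀ b j, φ b j ≤ c) (x : N.Vx) :
    N.lift φ a x ≤ c := by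
  rcases x with _ | ⟨b, i⟩
  exacts [ha, hφ _ _]

theorem le_lift {φ : Fin 3 → ℕ → ℝ} {a c : ℝ} (ha : c ≤ a) (hφ : ∀ b j, c ≤ φ b j) (x : N.Vx) :
    c ≤ N.lift φ a x := by
  rcases x with _ | ⟨b, i⟩
  exacts [ha, hφ _ _]

theorem sum_P_le {f : N.Vx → ℝ} {a : ℝ} (h : ∀ x, f x ≤ a) (x : N.Vx) :
    ∑ u, N.P x u * f u ≤ a := by
  calc ∑ u, N.P x u * f u ≤ ∑ u, N.P x u * a :=
        sum_le_sum fun u _ => mul_le_mul_of_nonneg_left (h u) (N.isStoch_P.1 x u)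
    _ = a := by rw [← sum_mul, N.isStoch_P.2, one_mul]

theorem sum_P_decay_le {z : ℝ} (hz : 1 ≤ z) (x : N.Vx) :
    ∑ u, N.P x u * N.lift (decay z) 1 u ≤ N.drift z⁻¹ * N.lift (decay z) 1 x := by
  have hz0 : 0 < z := by linarith
  have hr := N.hr0
  have hzz : z * z⁻¹ = 1 := mul_inv_cancel₀ hz0.ne'
  have h1 : ∀ x, N.lift (decay z) 1 x ≤ 1 := lift_le le_rfl (decay_le_one hz)
  have h2 := N.one_le_drift_inv hz
  have key : N.lift (decay z) 1 x = 1 →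
      ∑ u, N.P x u * N.lift (decay z) 1 u ≤ N.drift z⁻¹ * N.lift (decay z) 1 x := by
    intro h
    rw [h, mul_one]
    exact (sum_P_le h1 x).trans h2
  rcases x with _ | ⟨b, i⟩
  · exact key rfl
  · by_cases hb : b = 2
    · exact key (by simp [lift, decay, hb])
    · have h0 : ∀ b, decay z b 0 = 1 := by simp [decay]
      have hd : ∀ j, decay z b j = z⁻¹ ^ j := by simp [decay, hb]
      have e : N.lift (decay z) 1 (some (b, i)) = z⁻¹ ^ ((i : ℕ) + 1) := hd _
      rw [e]
      by_cases hi : (i : ℕ) + 1 < N.m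
      · rw [N.P_inner _ _ h0 hi (by tauto), hd, hd, drift, inv_inv]
        rw [div_mul_eq_mul_div]
        refine le_of_eq ?_
        congr 1
        linear_combination (-(z⁻¹ ^ (i : ℕ))) * hzz
      · have hi' : (i : ℕ) + 1 = N.m := by omega
        rw [N.P_top _ _ h0 hi', show decay z b N.m = z⁻¹ ^ ((i : ℕ) + 1) by rw [hd, hi'], hd]
        have h3 : N.across (decay z) b = 0 := by simp [across, decay]
        have h4 := mul_le_mul_of_nonneg_right (N.top_drift (inv_pos.2 hz0))
          (pow_pos (inv_pos.2 hz0) ((i : ℕ) + 1)).le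
        refine le_trans (le_of_eq ?_) h4
        rw [h3, inv_inv]
        linear_combination (-(N.v * z⁻¹ ^ (i : ℕ))) * hzz

theorem root_le {δ z : ℝ} (hδ0 : 0 < δ) (hδ1 : δ < 1) (hz : 1 ≤ z) (t : ℕ) (x : N.Vx) :
    (dLazy δ N.P ^ t) x none ≤ (δ + (1 - δ) * N.drift z⁻¹) ^ t * N.lift (decay z) 1 x := by
  have hM := N.isStoch_P.dLazy hδ0 hδ1
  have hR : 0 ≤ δ + (1 - δ) * N.drift z⁻¹ := by nlinarith [N.one_le_drift_inv hz]
  refine le_of_supersolution hM.1 ∅ (fun t x => (dLazy δ N.P ^ t) x none)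
    (fun t x => (δ + (1 - δ) * N.drift z⁻¹) ^ t * N.lift (decay z) 1 x) ?_ ?_ ?_ ?_ t x
  · intro t x
    rw [pow_succ', Matrix.mul_apply]
  · rintro (_ | ⟨b, i⟩)
    · simp [lift]
    · simp only [pow_zero, Matrix.one_apply, reduceCtorEq, if_false, one_mul]
      exact decay_nonneg hz _ _
  · intro t x hx
    exact absurd hx (by simp)
  · intro t x _
    have h := dLazy_sum_le hδ1 (sum_P_decay_le (N := N) hz x)
    have h2 := mul_le_mul_of_nonneg_left h (pow_nonneg hR t)
    simp only [mul_left_comm _ ((δ + (1 - δ) * N.drift z⁻¹) ^ t), ← mul_sum]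
    rw [pow_succ, mul_assoc]
    exact h2

theorem lift_decay_top {z : ℝ} {b : Fin 3} (hb : b ≠ 2) :
    N.lift (decay z) 1 (N.top b) = z⁻¹ ^ N.m := by
  have := N.m_pos
  simp only [top, lift, decay, if_neg hb]
  congr 1
  omega

/-- An upper bound for the kernel between the ends of the first two branches. -/
theorem ends_le {δ z θ : ℝ} (hδ0 : 0 < δ) (hδ1 : δ < 1) (hz : 1 ≤ z) (hθ : 0 < θ)
    (hθ1 : θ ≤ 1) (hrθ : N.r ≤ θ ^ 2) (hcθ : N.cross ≤ θ) (t : ℕ) :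
    (dLazy δ N.P ^ t) (N.top 0) (N.top 1) / N.sta (N.top 1) ≤
      (δ + (1 - δ) * N.drift z⁻¹) ^ t * z⁻¹ ^ (2 * N.m) / N.sta none +
      (δ + (1 - δ) * (4 * θ)) ^ t * (N.cross / θ) / N.sta (N.top 1) := by
  have hM := N.isStoch_P.dLazy hδ0 hδ1
  have hr := N.hr0
  have hz0 : 0 < z := by linarith
  set R := δ + (1 - δ) * N.drift z⁻¹ with hRdef
  set ρ := δ + (1 - δ) * (4 * θ) with hρdef
  set ε := N.cross / θ with hε
  have hε0 : 0 < ε := div_pos N.cross_pos hθ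
  have hε1 : ε ≤ 1 := (div_le_one hθ).2 hcθ
  have hcε : N.cross = ε * θ := by rw [hε]; field_simp
  have hR : 0 ≤ R := by nlinarith [N.one_le_drift_inv hz]
  have hρ : 0 ≤ ρ := by nlinarith
  have hπo := N.isProb_sta.1 none
  have hπw := N.isProb_sta.1 (N.top 1)
  set f : Fin 3 → ℕ → ℝ := fun b j => if j = 0 then 0 else if b = 2 then 0 else
    if b = 1 then θ ^ (N.m - j) else ε * θ ^ (N.m - j) with hf
  have hf0 : ∀ b, f b 0 = 0 := by simp [hf]
  have hf2 : ∀ j, f 2 j = 0 := by simp [hf]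
  have hfn : ∀ b j, 0 ≤ f b j := by
    intro b j; simp only [hf]; split_ifs <;> positivity
  have hf1 : ∀ b, b ≠ 2 → ∃ a, 0 ≤ a ∧ (∀ j, f b j ≤ a * θ ^ (N.m - j)) ∧
      (∀ j, j ≠ 0 → f b j = a * θ ^ (N.m - j)) ∧ N.cross * N.across f b ≤ θ * a := by
    have hm := N.m_pos
    intro b hb
    obtain rfl | rfl : b = 0 ∨ b = 1 := by omega
    · refine ⟨ε, hε0.le, fun j => ?_, fun j hj => ?_, ?_⟩
      · simp only [hf]
        simp
        split_ifs
        exacts [by positivity, le_rfl]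
      · simp [hf, hj]
      · simp [across, hf, hm.ne', hcε]
        nlinarith [mul_pos hθ hε0]
    · refine ⟨1, zero_le_one, fun j => ?_, fun j hj => ?_, ?_⟩
      · simp only [hf]
        simp
        split_ifs
        exacts [by positivity, le_rfl]
      · simp [hf, hj]
      · simp [across, hf, hm.ne']
        nlinarith [N.cross_pos]
  have hPf : ∀ b i, ∑ u, N.P (some (b, i)) u * N.lift f 0 u ≤
      4 * θ * N.lift f 0 (some (b, i)) := by
    intro b i
    by_cases hb : b = 2
    · subst hb
      have : N.lift f 0 (some (2, i)) = 0 := hf2 (i + 1)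
      rw [this]
      by_cases hi : (i : ℕ) + 1 < N.m
      · by_cases h : (i : ℕ) = N.k - 1
        · rw [N.P_chord _ _ hf0 h]; simp [hf2]
        · rw [N.P_inner _ _ hf0 hi (by tauto)]; simp [hf2]
      · rw [N.P_top _ _ hf0 (by omega)]; simp [hf2, across]
    · obtain ⟨a, ha, hle, heq, hac⟩ := hf1 b hb
      have e : N.lift f 0 (some (b, i)) = a * θ ^ (N.m - ((i : ℕ) + 1)) := heq (i + 1) (by omega)
      rw [e]
      by_cases hi : (i : ℕ) + 1 < N.m
      · rw [N.P_inner _ _ hf0 hi (by tauto), heq (i + 2) (by omega)]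
        obtain ⟨j, hj⟩ : ∃ j, N.m = (i : ℕ) + 2 + j := ⟨N.m - (i + 2), by omega⟩
        have h1 := hle i
        rw [show N.m - (i : ℕ) = j + 2 by omega] at h1
        rw [show N.m - ((i : ℕ) + 1) = j + 1 by omega, show N.m - ((i : ℕ) + 2) = j by omega,
          div_le_iff₀ (by linarith)]
        have h2 : 0 ≤ a * θ ^ j := by positivity
        have h3 : N.r * (a * θ ^ j) ≤ θ ^ 2 * (a * θ ^ j) := mul_le_mul_of_nonneg_right hrθ h2
        have h4 : 0 ≤ θ ^ 2 * (a * θ ^ j) := by positivity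
        have e1 : a * θ ^ (j + 2) = θ ^ 2 * (a * θ ^ j) := by ring
        have e2 : 4 * θ * (a * θ ^ (j + 1)) * (1 + N.r) =
          4 * (θ ^ 2 * (a * θ ^ j)) + 4 * N.r * (θ ^ 2 * (a * θ ^ j)) := by ring
        rw [e2]
        nlinarith
      · have hi' : (i : ℕ) + 1 = N.m := by omega
        rw [N.P_top _ _ hf0 hi', heq N.m N.m_pos.ne', hi']
        have h1 := hle i
        rw [show N.m - (i : ℕ) = 1 by omega, pow_one] at h1
        simp only [Nat.sub_self, pow_zero, mul_one]
        have h2 := N.one_sub_v_le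
        have h3 : N.v * f b i ≤ a * θ := by
          nlinarith [N.v_lt_one, N.v_pos, mul_nonneg ha hθ.le]
        have h5 : θ ^ 2 ≤ θ := by nlinarith
        have h4 : (1 - N.v) * a ≤ 2 * θ * a := mul_le_mul_of_nonneg_right (by linarith) ha
        nlinarith
  have hnn : ∀ x, 0 ≤ N.lift f 0 x := le_lift le_rfl hfn
  have hG := le_of_supersolution hM.1 {none}
    (fun t x => (dLazy δ N.P ^ t) x (N.top 1) / N.sta (N.top 1))
    (fun t x => R ^ t * z⁻¹ ^ N.m / N.sta none * N.lift (decay z) 1 x +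
      ρ ^ t / N.sta (N.top 1) * N.lift f 0 x) ?_ ?_ ?_ ?_ t (N.top 0)
  · refine hG.trans (le_of_eq ?_)
    have hm := N.m_pos
    have e1 : N.lift f 0 (N.top 0) = ε := by
      simp only [top, lift, show N.m - 1 + 1 = N.m by omega]
      simp [hf, hm.ne']
    simp only [lift_decay_top (show (0 : Fin 3) ≠ 2 by decide), e1]
    ring
  · intro t x
    rw [pow_succ', Matrix.mul_apply, sum_div]
    exact sum_congr rfl fun u _ => by ring
  · intro x
    have h1 : 0 ≤ z⁻¹ ^ N.m / N.sta none * N.lift (decay z) 1 x :=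
      mul_nonneg (by positivity) (le_lift zero_le_one (decay_nonneg hz) x)
    simp only [pow_zero, one_mul]
    by_cases hx : x = N.top 1
    · subst hx
      have hm := N.m_pos
      have e1 : N.lift f 0 (N.top 1) = 1 := by
        simp only [top, lift, show N.m - 1 + 1 = N.m by omega]
        simp [hf, hm.ne']
      rw [e1, Matrix.one_apply_eq]
      linarith
    · rw [Matrix.one_apply_ne hx, zero_div]
      have := hnn x
      positivity
  · rintro t x rfl
    have h1 := ((N.rev_P.dLazy δ).pow t) none (N.top 1)
    have h2 := root_le hδ0 hδ1 hz t (N.top 1)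
    rw [lift_decay_top (by decide)] at h2
    have e : (dLazy δ N.P ^ t) none (N.top 1) / N.sta (N.top 1) =
        (dLazy δ N.P ^ t) (N.top 1) none / N.sta none := by
      rw [div_eq_div_iff hπw.ne' hπo.ne']; linarith
    simp only [e]
    simp only [lift, mul_one, mul_zero, add_zero]
    exact div_le_div_of_nonneg_right h2 hπo.le
  · intro t x hx
    have e : ∑ u, dLazy δ N.P x u * (R ^ t * z⁻¹ ^ N.m / N.sta none * N.lift (decay z) 1 u +
        ρ ^ t / N.sta (N.top 1) * N.lift f 0 u) =
        R ^ t * z⁻¹ ^ N.m / N.sta none * ∑ u, dLazy δ N.P x u * N.lift (decay z) 1 u +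
        ρ ^ t / N.sta (N.top 1) * ∑ u, dLazy δ N.P x u * N.lift f 0 u := by
      rw [mul_sum, mul_sum, ← sum_add_distrib]
      exact sum_congr rfl fun u _ => by ring
    rw [e]
    rcases x with _ | ⟨b, i⟩
    · exact absurd rfl hx
    have h1 := dLazy_sum_le hδ1 (sum_P_decay_le (N := N) hz (some (b, i)))
    have h2 := dLazy_sum_le hδ1 (hPf b i)
    have h3 := mul_le_mul_of_nonneg_left h1
      (by positivity : 0 ≤ R ^ t * z⁻¹ ^ N.m / N.sta none)
    have h4 := mul_le_mul_of_nonneg_left h2 (by positivity : 0 ≤ ρ ^ t / N.sta (N.top 1))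
    refine (add_le_add h3 h4).trans (le_of_eq ?_)
    rw [← hRdef, ← hρdef]
    ring

end Net

namespace Net

variable {N : Net}

/-- An upper bound for the kernel between the ends of the third and the first branch: the chord
lets a walk from the end of the third branch reach the root early only with probability close to
one half. -/
theorem far_le {δ z θ : ℝ} (hδ0 : 0 < δ) (hδ1 : δ < 1) (hz : 1 ≤ z) (hθ : 0 < θ)
    (hθ1 : θ ≤ 1 / 2) (hrθ : N.r ≤ θ ^ 2) (t : ℕ) :
    (dLazy δ N.P ^ t) (N.top 2) (N.top 0) / N.sta (N.top 0) ≤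
      ((1 + θ) / 2 + (δ + (1 - δ) * N.drift z⁻¹) ^ t * z⁻¹ ^ (2 * N.m)) / N.sta none := by
  have hM := N.isStoch_P.dLazy hδ0 hδ1
  have hr := N.hr0
  have hz0 : 0 < z := by linarith
  have hk := N.hk
  have hkm := N.hkm
  have hzz : z * z⁻¹ = 1 := mul_inv_cancel₀ hz0.ne'
  set R := δ + (1 - δ) * N.drift z⁻¹ with hRdef
  have hR : 0 ≤ R := by nlinarith [N.one_le_drift_inv hz]
  have hπo := N.isProb_sta.1 none
  have hπz := N.isProb_sta.1 (N.top 0)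
  have hy0 : 0 < z⁻¹ := inv_pos.2 hz0
  set σ := (1 + θ) / 2 with hσ
  set ψ : ℕ → ℝ := fun j => if N.k ≤ j then σ else θ ^ (N.k - j) with hψ
  have hψσ : ∀ j, N.k ≤ j → ψ j = σ := fun j hj => if_pos hj
  have hψθ : ∀ j, ψ j ≤ θ ^ (N.k - j) := by
    intro j
    simp only [hψ]
    split_ifs with h
    · rw [Nat.sub_eq_zero_of_le h, pow_zero]; linarith
    · exact le_rfl
  have hψ0 : ∀ j, 0 ≤ ψ j := by
    intro j; simp only [hψ]; split_ifs <;> positivity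
  set c : ℕ → ℝ := fun t => R ^ t * z⁻¹ ^ N.m with hc
  have hc0 : ∀ t, 0 ≤ c t := fun t => by positivity
  set a : ℕ → ℝ := fun t => min 1 (c t) with ha
  set φ : ℕ → Fin 3 → ℕ → ℝ := fun t b j => if j = 0 then a t else
    if b = 2 then ψ j + c t * z⁻¹ ^ j else N.sta none / N.sta (N.top 0) with hφ
  have ha0 : ∀ t, 0 ≤ a t := fun t => le_min zero_le_one (hc0 t)
  have hφ0 : ∀ t b, φ t b 0 = a t := by simp [hφ]
  have hφe : ∀ t j, j ≠ 0 → φ t 2 j = ψ j + c t * z⁻¹ ^ j := by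
    intro t j hj; simp [hφ, hj]
  have hφn : ∀ t b j, 0 ≤ φ t b j := by
    intro t b j
    simp only [hφ]
    split_ifs
    · exact ha0 t
    · have := hψ0 j; have := hc0 t; positivity
    · positivity
  have hφle : ∀ t j, φ t 2 j ≤ ψ j + c t * z⁻¹ ^ j := by
    intro t j
    rcases Nat.eq_zero_or_pos j with rfl | hj
    · rw [hφ0, pow_zero, mul_one]
      exact (min_le_right _ _).trans (by linarith [hψ0 0])
    · exact (hφe t j hj.ne').le
  have hP : ∀ t i, ∑ u, N.P (some (2, i)) u * N.lift (φ t) (a t) u ≤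
      ψ (i + 1) + c t * (N.drift z⁻¹ * z⁻¹ ^ ((i : ℕ) + 1)) := by
    intro t i
    have hgeo : (z⁻¹ ^ (i : ℕ) + N.r * z⁻¹ ^ ((i : ℕ) + 2)) / (1 + N.r) =
        N.drift z⁻¹ * z⁻¹ ^ ((i : ℕ) + 1) := by
      rw [drift, inv_inv, div_mul_eq_mul_div]
      congr 1
      linear_combination (-(z⁻¹ ^ (i : ℕ))) * hzz
    have h1 := hφle t i
    have h2 := mul_le_mul_of_nonneg_left (hφle t (i + 2)) hr.le
    by_cases hi : (i : ℕ) + 1 < N.m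
    · by_cases h : (i : ℕ) = N.k - 1
      · rw [N.P_chord _ _ (hφ0 t) h, ← hgeo]
        have h3 : (φ t 2 i + N.r * φ t 2 (i + 2) + a t) / (2 + N.r) ≤
            (θ + N.r * σ + 1) / (2 + N.r) +
              c t * (z⁻¹ ^ (i : ℕ) + N.r * z⁻¹ ^ ((i : ℕ) + 2)) / (2 + N.r) := by
          rw [← add_div]
          refine div_le_div_of_nonneg_right ?_ (by linarith)
          have h4 := hψθ i
          rw [show N.k - (i : ℕ) = 1 by omega, pow_one] at h4
          rw [hψσ (i + 2) (by omega)] at h2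
          have h5 : a t ≤ 1 := min_le_left _ _
          nlinarith
        refine h3.trans (add_le_add ?_ ?_)
        · rw [hψσ _ (by omega), div_le_iff₀ (by linarith), hσ]
          linarith
        · rw [mul_div_assoc]
          refine mul_le_mul_of_nonneg_left ?_ (hc0 t)
          exact div_le_div_of_nonneg_left (by positivity) (by linarith) (by linarith)
      · rw [N.P_inner _ _ (hφ0 t) hi (by tauto), ← hgeo]
        have h3 : (φ t 2 i + N.r * φ t 2 (i + 2)) / (1 + N.r) ≤
            (ψ i + N.r * ψ (i + 2)) / (1 + N.r) +
              c t * ((z⁻¹ ^ (i : ℕ) + N.r * z⁻¹ ^ ((i : ℕ) + 2)) / (1 + N.r)) := by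
          rw [← mul_div_assoc, ← add_div]
          exact div_le_div_of_nonneg_right (by nlinarith) (by linarith)
        refine h3.trans (add_le_add_left ?_ _)
        rw [div_le_iff₀ (by linarith)]
        by_cases hki : N.k ≤ i
        · rw [hψσ i hki, hψσ _ (by omega), hψσ _ (by omega)]
          linarith
        · obtain ⟨j, hj⟩ : ∃ j, N.k = (i : ℕ) + 2 + j := ⟨N.k - (i + 2), by omega⟩
          have h4 := hψθ i
          have h5 := hψθ (i + 2)
          have h6 : ψ (i + 1) = θ ^ (j + 1) := by
            simp only [hψ]
            rw [if_neg (by omega)]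
            congr 1
            omega
          rw [show N.k - (i : ℕ) = j + 2 by omega] at h4
          rw [show N.k - ((i : ℕ) + 2) = j by omega] at h5
          rw [h6]
          have h7 : N.r * ψ (i + 2) ≤ θ ^ 2 * θ ^ j :=
            mul_le_mul hrθ h5 (hψ0 _) (by positivity)
          have h8 : θ ^ 2 * θ ^ j = θ * θ ^ (j + 1) := by ring
          have h9 : θ ^ (j + 2) = θ * θ ^ (j + 1) := by ring
          have h10 : 0 < θ ^ (j + 1) := by positivity
          nlinarith
    · have hi' : (i : ℕ) + 1 = N.m := by omega
      have h3 := hφle t N.m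
      have h4 : z⁻¹ ^ N.m = z⁻¹ ^ ((i : ℕ) + 1) := by rw [hi']
      rw [N.P_top _ _ (hφ0 t) hi']
      rw [hψσ _ hkm.le, h4] at h3
      rw [hψσ _ (by omega)] at h1
      rw [hψσ _ (by omega)]
      have h5 := mul_le_mul_of_nonneg_right (N.top_drift hy0) (pow_pos hy0 ((i : ℕ) + 1)).le
      have h6 : (N.v * z⁻¹⁻¹ + (1 - N.v)) * z⁻¹ ^ ((i : ℕ) + 1) =
          N.v * z⁻¹ ^ (i : ℕ) + (1 - N.v) * z⁻¹ ^ ((i : ℕ) + 1) := by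
        rw [inv_inv]
        linear_combination (N.v * z⁻¹ ^ (i : ℕ)) * hzz
      rw [h6] at h5
      have h7 := mul_le_mul_of_nonneg_left h5 (hc0 t)
      have h8 := mul_le_mul_of_nonneg_left h1 N.v_pos.le
      have h9 := mul_le_mul_of_nonneg_left h3 (by linarith [N.v_lt_one] : 0 ≤ 1 - N.v)
      have h10 : N.across (φ t) 2 = 0 := by simp [across]
      rw [h10]
      linarith
  have hG := le_of_supersolution hM.1 {x | ∀ i, x ≠ some (2, i)}
    (fun t x => (dLazy δ N.P ^ t) x (N.top 0) / N.sta (N.top 0))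
    (fun t x => N.lift (φ t) (a t) x / N.sta none) ?_ ?_ ?_ ?_ t (N.top 2)
  · refine hG.trans (div_le_div_of_nonneg_right (le_of_eq ?_) hπo.le)
    have hm := N.m_pos
    simp only [top, lift, show N.m - 1 + 1 = N.m by omega]
    rw [hφe t N.m hm.ne', hψσ _ hkm.le]
    simp only [hc]
    ring
  · intro t x
    rw [pow_succ', Matrix.mul_apply, sum_div]
    exact sum_congr rfl fun u _ => by ring
  · intro x
    by_cases hx : x = N.top 0
    · subst hx
      have hm := N.m_pos
      have e1 : N.lift (φ 0) (a 0) (N.top 0) = N.sta none / N.sta (N.top 0) := by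
        simp only [top, lift, show N.m - 1 + 1 = N.m by omega]
        simp [hφ, hm.ne', top]
      simp only [e1, pow_zero, Matrix.one_apply_eq]
      rw [div_div, mul_comm, ← div_div, div_self hπo.ne']
    · simp only [pow_zero, Matrix.one_apply_ne hx, zero_div]
      have h1 : 0 ≤ N.lift (φ 0) (a 0) x := le_lift (ha0 0) (hφn 0) x
      positivity
  · intro t x hx
    rcases x with _ | ⟨b, i⟩
    · have h1 := ((N.rev_P.dLazy δ).pow t) none (N.top 0)
      have h2 := root_le hδ0 hδ1 hz t (N.top 0)
      rw [lift_decay_top (by decide)] at h2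
      have h3 := (hM.pow t).le_one (N.top 0) none
      have e : (dLazy δ N.P ^ t) none (N.top 0) / N.sta (N.top 0) =
          (dLazy δ N.P ^ t) (N.top 0) none / N.sta none := by
        rw [div_eq_div_iff hπz.ne' hπo.ne']; linarith
      simp only [e]
      exact div_le_div_of_nonneg_right (le_min h3 h2) hπo.le
    · have hb : b ≠ 2 := fun h => hx i (by rw [h])
      have e1 : N.lift (φ t) (a t) (some (b, i)) = N.sta none / N.sta (N.top 0) := by
        simp [lift, hφ, hb]
      simp only [e1]
      rw [div_div, mul_comm, ← div_div, div_self hπo.ne']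
      exact div_le_div_of_nonneg_right ((hM.pow t).le_one _ _) hπz.le
  · intro t x hx
    obtain ⟨i, rfl⟩ : ∃ i, x = some (2, i) := by simpa using hx
    have e : ∑ u, dLazy δ N.P (some (2, i)) u * (N.lift (φ t) (a t) u / N.sta none) =
        (∑ u, dLazy δ N.P (some (2, i)) u * N.lift (φ t) (a t) u) / N.sta none := by
      rw [sum_div]
      exact sum_congr rfl fun u _ => by ring
    rw [e]
    refine div_le_div_of_nonneg_right ?_ hπo.le
    rw [dLazy_apply_sum]
    have e2 : ∀ t, N.lift (φ t) (a t) (some (2, i)) =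
      ψ (i + 1) + c t * z⁻¹ ^ ((i : ℕ) + 1) := fun t => hφe t (i + 1) (by omega)
    have h1 := mul_le_mul_of_nonneg_left (hP t i) (by linarith : 0 ≤ 1 - δ)
    rw [e2, e2]
    have e3 : c (t + 1) = R * c t := by simp only [hc]; ring
    rw [e3, hRdef]
    linarith

theorem climb {δ : ℝ} (hδ0 : 0 < δ) (hδ1 : δ < 1) {b : Fin 3} (hb : b ≠ 2) (d i : ℕ)
    (hi : i + d + 1 = N.m) :
    ((1 - δ) * (N.r / (1 + N.r))) ^ d ≤
      (dLazy δ N.P ^ d) (some (b, ⟨i, by omega⟩)) (N.top b) := by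
  have hM := N.isStoch_P.dLazy hδ0 hδ1
  have hr := N.hr0
  induction d generalizing i with
  | zero =>
    have : N.top b = some (b, ⟨i, by omega⟩) := by
      simp only [top, Option.some.injEq, Prod.mk.injEq, true_and, Fin.mk.injEq]
      omega
    rw [this]
    simp
  | succ d ih =>
    have h1 := ih (i + 1) (by omega)
    have h2 := dLazy_apply_ge (P := N.P) hδ0 (some (b, ⟨i, by omega⟩))
      (some (b, ⟨i + 1, by omega⟩))
    rw [N.P_up (by omega) hb] at h2
    have h3 := pow_add_ge hM 1 d (some (b, ⟨i, by omega⟩)) (some (b, ⟨i + 1, by omega⟩)) (N.top b)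
    rw [pow_one, add_comm 1 d] at h3
    rw [pow_succ' ((1 - δ) * (N.r / (1 + N.r)))]
    have h4 : 0 ≤ (1 - δ) * (N.r / (1 + N.r)) := mul_nonneg (by linarith) (by positivity)
    exact (mul_le_mul h2 h1 (by positivity) (h4.trans h2)).trans h3

theorem ends_ge {δ : ℝ} (hδ0 : 0 < δ) (hδ1 : δ < 1) {b b' : Fin 3} (hb : b ≠ 2) (hb' : b' ≠ 2)
    {n : ℕ} (hn : 1 ≤ n) :
    δ ^ n * ((1 - δ) * N.cross) ≤ (dLazy δ N.P ^ n) (N.top b) (N.top b') := by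
  have hM := N.isStoch_P.dLazy hδ0 hδ1
  have h0 := N.cross_pos
  have h1 : N.cross ≤ 1 := by linarith [N.cross_le, N.v_pos]
  have h2 : (1 - δ) * N.cross ≤ 1 := by nlinarith
  have h3 : 0 ≤ (1 - δ) * N.cross := mul_nonneg (by linarith) h0.le
  by_cases h : b = b'
  · subst h
    exact (mul_le_of_le_one_right (by positivity) h2).trans
      (dLazy_pow_hold N.isStoch_P hδ0 hδ1 n _)
  · have h4 := dLazy_apply_ge (P := N.P) hδ0 (N.top b) (N.top b')
    rw [N.P_cross hb hb' h] at h4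
    obtain ⟨j, rfl⟩ : ∃ j, n = j + 1 := ⟨n - 1, by omega⟩
    have h5 := dLazy_pow_hold N.isStoch_P hδ0 hδ1 j (N.top b)
    have h6 := pow_add_ge hM j 1 (N.top b) (N.top b) (N.top b')
    rw [pow_one] at h6
    refine le_trans ?_ h6
    refine le_trans ?_ (mul_le_mul h5 h4 h3 ((hM.pow j).1 _ _))
    exact mul_le_mul_of_nonneg_right (pow_le_pow_of_le_one hδ0.le hδ1.le (by omega)) h3

/-- A lower bound for the kernel between vertices close to the ends of the first two branches. -/
theorem near_ends_ge {δ : ℝ} (hδ0 : 0 < δ) (hδ1 : δ < 1) {b b' : Fin 3} (hb : b ≠ 2)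
    (hb' : b' ≠ 2) (i j : Fin N.m) {t : ℕ}
    (h1 : N.m - ((i : ℕ) + 1) + (N.m - ((j : ℕ) + 1)) ≤ N.k) (h2 : N.k < t) :
    ((1 - δ) * (N.r / (1 + N.r))) ^ N.k * (δ ^ t * ((1 - δ) * N.cross)) / N.sta (N.top 0) ≤
      (dLazy δ N.P ^ t) (some (b, i)) (some (b', j)) / N.sta (some (b', j)) := by
  have hM := N.isStoch_P.dLazy hδ0 hδ1
  have hr := N.hr0
  set β := (1 - δ) * (N.r / (1 + N.r)) with hβ
  have hr1 : N.r / (1 + N.r) ≤ 1 := (div_le_one (by linarith)).2 (by linarith)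
  have hr2 : 0 ≤ N.r / (1 + N.r) := by positivity
  have hβ0 : 0 ≤ β := mul_nonneg (by linarith) (by positivity)
  have hβ1 : β ≤ 1 := by nlinarith
  have hc0 : 0 ≤ (1 - δ) * N.cross := mul_nonneg (by linarith) N.cross_pos.le
  obtain ⟨d, hd⟩ : ∃ d, (i : ℕ) + d + 1 = N.m := ⟨N.m - (i + 1), by omega⟩
  obtain ⟨d', hd'⟩ : ∃ d', (j : ℕ) + d' + 1 = N.m := ⟨N.m - (j + 1), by omega⟩
  obtain ⟨n, rfl⟩ : ∃ n, t = d + n + d' := ⟨t - d - d', by omega⟩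
  have c1 := climb hδ0 hδ1 hb d i hd
  have c2 := climb hδ0 hδ1 hb' d' j hd'
  have c3 := ends_ge (N := N) hδ0 hδ1 hb hb' (n := n) (by omega)
  have h3 := two_leg hM N.isProb_sta (N.rev_P.dLazy δ) (d + n) d' (some (b, i)) (N.top b')
    (some (b', j))
  have h4 := pow_add_ge hM d n (some (b, i)) (N.top b) (N.top b')
  refine le_trans ?_ h3
  have e : N.sta (N.top b') = N.sta (N.top 0) := by rw [N.sta_top, N.sta_top]
  rw [e]
  refine div_le_div_of_nonneg_right ?_ (N.isProb_sta.1 _).le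
  have h5 : β ^ d * (δ ^ n * ((1 - δ) * N.cross)) * β ^ d' ≤
      (dLazy δ N.P ^ (d + n)) (some (b, i)) (N.top b') *
        (dLazy δ N.P ^ d') (some (b', j)) (N.top b') :=
    mul_le_mul ((mul_le_mul c1 c3 (by positivity) ((hM.pow d).1 _ _)).trans h4) c2
      (by positivity) ((hM.pow _).1 _ _)
  refine le_trans ?_ h5
  have h6 : β ^ N.k ≤ β ^ (d + d') := pow_le_pow_of_le_one hβ0 hβ1 (by omega)
  have h7 : δ ^ (d + n + d') ≤ δ ^ n := pow_le_pow_of_le_one hδ0.le hδ1.le (by omega)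
  calc β ^ N.k * (δ ^ (d + n + d') * ((1 - δ) * N.cross))
      ≤ β ^ (d + d') * (δ ^ n * ((1 - δ) * N.cross)) :=
        mul_le_mul h6 (mul_le_mul_of_nonneg_right h7 hc0) (by positivity) (by positivity)
    _ = _ := by ring

end Net

namespace Net

variable {N : Net}

theorem drift_exp_le {s : ℝ} (hs : |s| ≤ 1) : N.drift (Real.exp s) ≤ 1 - N.v * s + s ^ 2 := by
  have hr := N.hr0
  have h1 := (abs_le.1 (Real.abs_exp_sub_one_sub_id_le hs)).2
  have h2 := (abs_le.1 (Real.abs_exp_sub_one_sub_id_le (x := -s) (by rwa [abs_neg]))).2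
  have h3 : N.v * (1 + N.r) = 1 - N.r := by
    unfold v; field_simp
  rw [drift, ← Real.exp_neg, div_le_iff₀ (by linarith)]
  have h4 : (1 - N.v * s + s ^ 2) * (1 + N.r) =
      (1 + N.r) - (N.v * (1 + N.r)) * s + s ^ 2 * (1 + N.r) := by ring
  rw [h4, h3]
  nlinarith

/-- The drift of the lazy chain. -/
theorem lazy_drift_pow_le {δ s : ℝ} (hδ0 : 0 < δ) (hδ1 : δ < 1) (hs : |s| ≤ 1) (t : ℕ) :
    (δ + (1 - δ) * N.drift (Real.exp s)) ^ t ≤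
      Real.exp (-((1 - δ) * N.v * t) * s + t * s ^ 2) := by
  have h1 := N.drift_exp_le hs
  have h0 : 0 ≤ δ + (1 - δ) * N.drift (Real.exp s) := by
    nlinarith [N.drift_pos (Real.exp_pos s)]
  have h2 : δ + (1 - δ) * N.drift (Real.exp s) ≤
      Real.exp (-((1 - δ) * N.v) * s + s ^ 2) := by
    refine le_trans ?_ (Real.add_one_le_exp _)
    nlinarith [sq_nonneg s, mul_nonneg hδ0.le (sq_nonneg s),
      mul_le_mul_of_nonneg_left h1 (by linarith : 0 ≤ 1 - δ)]
  refine (pow_le_pow_left₀ h0 h2 t).trans (le_of_eq ?_)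
  rw [← Real.exp_nat_mul]
  congr 1
  ring

theorem eventually_exp_neg_le {c η : ℝ} (hc : 0 < c) (hη : 0 < η) :
    ∀ᶠ m : ℕ in atTop, Real.exp (-(c * m)) ≤ η := by
  have h1 : Tendsto (fun m : ℕ => c * (m : ℝ)) atTop atTop :=
    tendsto_natCast_atTop_atTop.const_mul_atTop hc
  exact (Real.tendsto_exp_neg_atTop_nhds_zero.comp h1).eventually_le_const hη

theorem eventually_div_le (c : ℝ) {η : ℝ} (hη : 0 < η) : ∀ᶠ m : ℕ in atTop, c / (m : ℝ) ≤ η :=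
  (tendsto_const_div_atTop_nhds_zero_nat c).eventually_le_const hη

/-- The height of a vertex. -/
def height : N.Vx → ℕ
  | none => 0
  | some x => x.2 + 1

theorem height_le (x : N.Vx) : height x ≤ N.m := by
  rcases x with _ | ⟨b, i⟩
  · exact Nat.zero_le _
  · have := i.2
    simp only [height]
    omega

/-- The common estimate for the errors in `root_hit` and `root_hit_chord`. -/
theorem error_le {δ l C η : ℝ} (hδ0 : 0 < δ) (hδ1 : δ < 1) (hl : 0 < l) (hC : 0 < C)
    (hη : 0 < η) : ∃ z : ℝ, 1 ≤ z ∧ z ≤ 3 ∧ ∀ᶠ m : ℕ in atTop, ∀ N : Net, N.m = m →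
      N.τ = 1 / (m : ℝ) ^ 2 → ∀ t : ℕ, (t : ℝ) ≤ C * m → 8 * N.τ * z * t ≤ η ∧
      ∀ h : ℕ, h + l * m ≤ (1 - δ) * N.v * t →
        (δ + (1 - δ) * N.drift z) ^ t * z ^ h + 8 * N.τ * z * t ≤ η := by
  set s := min 1 (l / (2 * C)) with hs
  have hs0 : 0 < s := lt_min one_pos (by positivity)
  have hs1 : s ≤ 1 := min_le_left _ _
  have hsC : s * C ≤ l / 2 := by
    calc s * C ≤ l / (2 * C) * C := mul_le_mul_of_nonneg_right (min_le_right _ _) hC.le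
      _ = l / 2 := by field_simp
  have hz3 : Real.exp s ≤ 3 := by
    have := Real.exp_one_lt_d9
    linarith [Real.exp_le_exp.2 hs1]
  refine ⟨Real.exp s, Real.one_le_exp hs0.le, hz3, ?_⟩
  filter_upwards [eventually_exp_neg_le (mul_pos hs0 (half_pos hl)) (half_pos hη),
    eventually_div_le (24 * C) (half_pos hη), eventually_gt_atTop 0] with m h1 h2 hm N hNm hτ t ht
  have hm' : (0 : ℝ) < m := by exact_mod_cast hm
  have h3 : 8 * N.τ * Real.exp s * t ≤ η / 2 := by
    refine le_trans ?_ h2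
    rw [hτ, le_div_iff₀ hm']
    have e : 8 * (1 / (m : ℝ) ^ 2) * Real.exp s * t * m = 8 * Real.exp s * (t / m) := by
      field_simp
    rw [e]
    have h4 : (t : ℝ) / m ≤ C := by rwa [div_le_iff₀ hm']
    have h5 : (0 : ℝ) ≤ t / m := by positivity
    nlinarith [Real.exp_pos s]
  refine ⟨by linarith, fun h hh => ?_⟩
  have h4 : (δ + (1 - δ) * N.drift (Real.exp s)) ^ t * Real.exp s ^ h ≤ η / 2 := by
    refine le_trans ?_ h1
    rw [← Real.exp_nat_mul]
    refine (mul_le_mul_of_nonneg_right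
      (lazy_drift_pow_le hδ0 hδ1 (by rwa [abs_of_pos hs0]) t) (Real.exp_pos _).le).trans ?_
    rw [← Real.exp_add, Real.exp_le_exp]
    have h5 := mul_le_mul_of_nonneg_right hh hs0.le
    have h6 : t * s ^ 2 ≤ l / 2 * m * s := by
      have : t * s ^ 2 ≤ C * m * s ^ 2 := mul_le_mul_of_nonneg_right ht (sq_nonneg s)
      nlinarith [mul_le_mul_of_nonneg_right hsC (mul_pos hm' hs0).le]
    linarith
  linarith

theorem eventually_root_hit {δ l C η : ℝ} (hδ0 : 0 < δ) (hδ1 : δ < 1) (hl : 0 < l) (hC : 0 < C)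
    (hη : 0 < η) : ∀ᶠ m : ℕ in atTop, ∀ N : Net, N.m = m →
      N.τ = 1 / (m : ℝ) ^ 2 → ∀ t : ℕ, (t : ℝ) ≤ C * m →
      (∀ x : N.Vx, height x + l * m ≤ (1 - δ) * N.v * t →
        1 - η ≤ (dLazy δ N.P ^ t) x none) ∧
      ∀ i : Fin N.m, N.k ≤ (i : ℕ) + 1 → ((i : ℕ) + 1 - N.k : ℕ) + l * m ≤ (1 - δ) * N.v * t →
        1 / 2 - η ≤ (dLazy δ N.P ^ t) (some (2, i)) none := by
  obtain ⟨z, hz1, hz3, h⟩ := error_le hδ0 hδ1 hl hC hη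
  filter_upwards [h] with m h N hNm hτ t ht
  obtain ⟨h1, h2⟩ := h N hNm hτ t ht
  have hrz : N.r * z ≤ 1 := by nlinarith [N.hr, N.hr0]
  refine ⟨fun x hx => ?_, fun i hi hx => ?_⟩
  · rcases x with _ | ⟨b, i⟩
    · have := root_hit_root (N := N) hδ0 hδ1 hz1 hrz t
      linarith
    · have := root_hit (N := N) hδ0 hδ1 hz1 hrz t b i
      have := h2 _ hx
      simp only [height] at this
      linarith
  · have := root_hit_chord (N := N) hδ0 hδ1 hz1 hrz t i hi
    have := h2 _ hx
    linarith

theorem eventually_decay_le {δ l η : ℝ} (hδ0 : 0 < δ) (hδ1 : δ < 1) (hl : 0 < l)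
    (hη : 0 < η) : ∃ z : ℝ, 1 ≤ z ∧ ∀ᶠ m : ℕ in atTop, ∀ N : Net, N.m = m → ∀ t : ℕ,
      (1 - δ) * N.v * t ≤ (2 - l) * m →
      (δ + (1 - δ) * N.drift z⁻¹) ^ t * z⁻¹ ^ (2 * N.m) ≤ η := by
  have hδ : 0 < 1 - δ := by linarith
  set C := 4 / (1 - δ) with hCdef
  have hC : 0 < C := by positivity
  set s := min 1 (l / (2 * C)) with hs
  have hs0 : 0 < s := lt_min one_pos (by positivity)
  have hs1 : s ≤ 1 := min_le_left _ _
  have hsC : s * C ≤ l / 2 := by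
    calc s * C ≤ l / (2 * C) * C := mul_le_mul_of_nonneg_right (min_le_right _ _) hC.le
      _ = l / 2 := by field_simp
  refine ⟨Real.exp s, Real.one_le_exp hs0.le, ?_⟩
  filter_upwards [eventually_exp_neg_le (mul_pos hs0 (half_pos hl)) hη] with m h1 N hNm t ht
  refine le_trans ?_ h1
  rw [← Real.exp_neg, ← Real.exp_nat_mul]
  have hm' : (0 : ℝ) ≤ m := Nat.cast_nonneg m
  have htC : (t : ℝ) ≤ C * m := by
    have h2 := N.half_le_v
    have h3 : (1 - δ) * (1 / 2) * t ≤ (1 - δ) * N.v * t := by gcongr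
    rw [hCdef, div_mul_eq_mul_div, le_div_iff₀ hδ]
    nlinarith [mul_nonneg hl.le hm']
  refine (mul_le_mul_of_nonneg_right
    (lazy_drift_pow_le hδ0 hδ1 (by rwa [abs_neg, abs_of_pos hs0]) t) (Real.exp_pos _).le).trans ?_
  rw [← Real.exp_add, Real.exp_le_exp]
  have h5 := mul_le_mul_of_nonneg_right ht hs0.le
  have h6 : t * s ^ 2 ≤ l / 2 * m * s := by
    have : t * s ^ 2 ≤ C * m * s ^ 2 := mul_le_mul_of_nonneg_right htC (sq_nonneg s)
    nlinarith [mul_le_mul_of_nonneg_right hsC (mul_nonneg hm' hs0.le)]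
  push_cast
  rw [hNm]
  linarith

end Net

namespace Net

variable {N : Net}

theorem speed_pos {δ : ℝ} (hδ1 : δ < 1) : 0 < (1 - δ) * N.v :=
  mul_pos (by linarith) N.v_pos

theorem speed_le_one {δ : ℝ} (hδ0 : 0 < δ) : (1 - δ) * N.v ≤ 1 :=
  mul_le_one₀ (by linarith) N.v_pos.le N.v_lt_one.le

theorem exists_time (N : Net) {δ a : ℝ} (hδ0 : 0 < δ) (hδ1 : δ < 1) (ha : 0 ≤ a) :
    ∃ s : ℕ, a ≤ (1 - δ) * N.v * s ∧ (1 - δ) * N.v * s ≤ a + 1 := by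
  have h := N.speed_pos hδ1
  have h' := N.speed_le_one hδ0
  refine ⟨⌈a / ((1 - δ) * N.v)⌉₊, ?_, ?_⟩
  · have := Nat.le_ceil (a / ((1 - δ) * N.v))
    rwa [div_le_iff₀' h] at this
  · have h2 := (Nat.ceil_lt_add_one (div_nonneg ha h.le)).le
    calc _ ≤ (1 - δ) * N.v * (a / ((1 - δ) * N.v) + 1) := mul_le_mul_of_nonneg_left h2 h.le
      _ = a + (1 - δ) * N.v := by rw [mul_add, mul_div_cancel₀ _ h.ne', mul_one]
      _ ≤ a + 1 := by linarith

theorem time_le {δ b : ℝ} (hδ1 : δ < 1) {s : ℕ} (h : (1 - δ) * N.v * s ≤ b) :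
    (s : ℝ) ≤ 2 / (1 - δ) * b := by
  have hδ : 0 < 1 - δ := by linarith
  rw [div_mul_eq_mul_div, le_div_iff₀ hδ]
  have h2 : (1 - δ) * (1 / 2) * s ≤ (1 - δ) * N.v * s := by
    gcongr
    exact N.half_le_v
  linarith

theorem time_bound {δ : ℝ} (hδ1 : δ < 1) {s m : ℕ} (h : (1 - δ) * N.v * s ≤ 4 * (m : ℝ)) :
    (s : ℝ) ≤ 8 / (1 - δ) * m := by
  refine (time_le hδ1 h).trans (le_of_eq ?_)
  ring

theorem isStoch_lazy {δ : ℝ} (hδ0 : 0 < δ) (hδ1 : δ < 1) : IsStoch (dLazy δ N.P) :=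
  N.isStoch_P.dLazy hδ0 hδ1

/-- Two chains meeting at the root. -/
theorem meet_root {δ a b : ℝ} (hδ0 : 0 < δ) (hδ1 : δ < 1) (ha : 0 ≤ a) (hb : 0 ≤ b) {s u : ℕ}
    {x y : N.Vx} (hx : a ≤ (dLazy δ N.P ^ s) x none) (hy : b ≤ (dLazy δ N.P ^ u) y none) :
    a * b ≤ (dLazy δ N.P ^ (s + u)) x y / N.sta y := by
  have h := two_leg (isStoch_lazy hδ0 hδ1) N.isProb_sta (N.rev_P.dLazy δ) s u x none y
  refine le_trans ?_ h
  have h1 : 0 < N.sta none := N.isProb_sta.1 none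
  have h2 : N.sta none ≤ 1 := by
    rw [← N.isProb_sta.2]
    exact single_le_sum (fun i _ => (N.isProb_sta.1 i).le) (mem_univ none)
  rw [le_div_iff₀ h1]
  calc a * b * N.sta none ≤ a * b * 1 := mul_le_mul_of_nonneg_left h2 (mul_nonneg ha hb)
    _ ≤ _ := by
      rw [mul_one]
      exact mul_le_mul hx hy hb (ha.trans hx)

theorem eventually_dSep_le {δ ε l : ℝ} (hδ0 : 0 < δ) (hδ1 : δ < 1) (hε : 0 < ε) (hε1 : ε < 1)
    (hl : 0 < l) (hl1 : l ≤ 1) : ∀ᶠ m : ℕ in atTop, ∀ N : Net, N.m = m → N.τ = 1 / (m : ℝ) ^ 2 →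
      ∃ t : ℕ, (1 - δ) * N.v * t ≤ (2 + l) * m ∧ dSep (dLazy δ N.P) N.sta t ≤ ε := by
  have hδ : 0 < 1 - δ := by linarith
  filter_upwards [eventually_root_hit hδ0 hδ1 (by positivity : 0 < l / 4)
    (by positivity : 0 < 8 / (1 - δ)) (half_pos hε), eventually_div_le (4 / l) one_pos,
    eventually_gt_atTop 0] with m h hm1 hm0 N hNm hτ
  have hm : (0 : ℝ) < m := by exact_mod_cast hm0
  have hml : 1 ≤ l / 4 * m := by
    rw [div_le_one hm, div_le_iff₀ hl] at hm1
    linarith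
  obtain ⟨s, hs1, hs2⟩ := N.exists_time hδ0 hδ1 (by positivity : 0 ≤ (1 + l / 4) * m)
  have hs4 : (1 - δ) * N.v * s ≤ 4 * (m : ℝ) := by nlinarith
  have hit (x : N.Vx) : 1 - ε / 2 ≤ (dLazy δ N.P ^ s) x none := by
    refine (h N hNm hτ s (time_bound hδ1 hs4)).1 x ?_
    have : (height x : ℝ) ≤ m := by exact_mod_cast hNm ▸ height_le x
    linarith
  refine ⟨s + s, ?_, ?_⟩
  · push_cast
    linarith
  · have := dSep_le (M := dLazy δ N.P) (π := N.sta) (t := s + s) (c := 1 - ε) fun x y => by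
      refine le_trans ?_ (meet_root hδ0 hδ1 (by linarith) (by linarith) (hit x) (hit y))
      nlinarith
    linarith

theorem cross_div_sta {κ : ℝ} (hX : N.X = Real.exp (κ * N.m) * (N.τ * N.r ^ (N.m - 1)) ^ 2)
    (b : Fin 3) : N.cross / N.sta (N.top b) = Real.exp (κ * N.m) * N.v ^ 2 * N.W := by
  have h1 := N.W_pos
  have h2 := N.v_pos
  have h3 : 0 < N.τ * N.r ^ (N.m - 1) := mul_pos N.hτ (pow_pos N.hr0 _)
  rw [N.sta_top, cross, hX]
  generalize N.τ * N.r ^ (N.m - 1) = a at h3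
  field_simp

theorem W_le_two {m : ℕ} (hm : 16 ≤ m) (hNm : N.m = m) (hτ : N.τ = 1 / (m : ℝ) ^ 2) :
    N.W ≤ 1 + 16 / m := by
  have hm0 : (0 : ℝ) < m := by
    have : 0 < m := by omega
    exact_mod_cast this
  refine N.W_le.trans (le_of_eq ?_)
  rw [hNm, hτ]
  field_simp

theorem inv_sta_root_le : 1 / N.sta none ≤ N.W := by
  have h1 := N.c_root_ge
  have h2 := N.W_pos
  rw [sta, one_div_div, div_le_iff₀ (by linarith)]
  nlinarith

/-- The probability of travelling between the two tops stays small before time `2 * m` if the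
crossing is never exploited. -/
theorem eventually_lt_dSep {δ ε l θ κ : ℝ} (hδ0 : 0 < δ) (hδ1 : δ < 1) (hε1 : ε < 1)
    (hl : 0 < l) (hθ : 0 < θ) (hθ1 : 4 * θ ≤ 1) {v : ℝ} (hv : 0 < v)
    (hκ : κ * v < 2 * (-Real.log (δ + (1 - δ) * (4 * θ)) / (1 - δ))) :
    ∀ᶠ m : ℕ in atTop, ∀ N : Net, N.m = m → N.τ = 1 / (m : ℝ) ^ 2 → N.v = v → N.r ≤ θ ^ 2 →
      N.cross ≤ θ → N.X = Real.exp (κ * N.m) * (N.τ * N.r ^ (N.m - 1)) ^ 2 →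
      ∃ t : ℕ, (2 - l) * m ≤ (1 - δ) * N.v * t ∧ ε < dSep (dLazy δ N.P) N.sta t := by
  have hδ : 0 < 1 - δ := by linarith
  set ρ := δ + (1 - δ) * (4 * θ) with hρ
  have hρ0 : 0 < ρ := by positivity
  set R := -Real.log ρ / ((1 - δ) * v) with hR
  have hκR : κ < 2 * R := by
    rw [hR, ← div_div, ← mul_div_assoc, lt_div_iff₀ hv]
    linarith
  have hR0 : 0 ≤ R := by
    have : Real.log ρ ≤ 0 := Real.log_nonpos hρ0.le (by nlinarith)
    exact div_nonneg (by linarith) (by positivity)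
  obtain ⟨l', hl'0, hl'l, hl'1, hl'R⟩ : ∃ l' : ℝ, 0 < l' ∧ l' ≤ l ∧ l' ≤ 1 ∧ κ < (2 - l') * R := by
    have h1 : 0 < (2 * R - κ) / (2 * (R + 1)) := div_pos (by linarith) (by linarith)
    refine ⟨min l (min 1 ((2 * R - κ) / (2 * (R + 1)))), lt_min hl (lt_min one_pos h1),
      min_le_left _ _, (min_le_right _ _).trans (min_le_left _ _), ?_⟩
    set y := min l (min 1 ((2 * R - κ) / (2 * (R + 1))))
    have h2 : y ≤ (2 * R - κ) / (2 * (R + 1)) := (min_le_right _ _).trans (min_le_right _ _)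
    have h3 : 0 < y := lt_min hl (lt_min one_pos h1)
    rw [le_div_iff₀ (by linarith)] at h2
    nlinarith
  have hη : 0 < (1 - ε) / 8 := by linarith
  obtain ⟨z, hz, hev⟩ := eventually_decay_le hδ0 hδ1 (half_pos hl'0) hη
  have hc : 0 < (2 - l') * R - κ := by linarith
  filter_upwards [hev, eventually_exp_neg_le hc
    (by positivity : 0 < (1 - ε) / 8 * θ), eventually_ge_atTop 16,
    eventually_div_le (2 / l') one_pos] with m h1 h2 hm hml N hNm hτ hNv hr hcross hX
  have hm0 : (0 : ℝ) < m := by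
    have : 0 < m := by omega
    exact_mod_cast this
  have hml' : 1 ≤ l' / 2 * m := by
    rw [div_le_one hm0, div_le_iff₀ hl'0] at hml
    linarith
  obtain ⟨t, ht1, ht2⟩ := N.exists_time hδ0 hδ1
    (mul_nonneg (by linarith : 0 ≤ 2 - l') hm0.le)
  refine ⟨t, by nlinarith, ?_⟩
  have hW : N.W ≤ 2 := by
    refine (W_le_two hm hNm hτ).trans ?_
    have : (16 : ℝ) / m ≤ 1 := by
      rw [div_le_one hm0]
      exact_mod_cast hm
    linarith
  have hA : (δ + (1 - δ) * N.drift z⁻¹) ^ t * z⁻¹ ^ (2 * N.m) / N.sta none ≤ (1 - ε) / 4 := by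
    have h3 := h1 N hNm t (by linarith)
    rw [div_eq_mul_one_div]
    calc _ ≤ (1 - ε) / 8 * 2 := mul_le_mul h3 (inv_sta_root_le.trans hW)
          (one_div_nonneg.2 (N.isProb_sta.1 none).le) hη.le
      _ = _ := by ring
  have hB : ρ ^ t * (N.cross / θ) / N.sta (N.top 1) ≤ (1 - ε) / 4 := by
    have e : ρ ^ t * (N.cross / θ) / N.sta (N.top 1) =
        ρ ^ t * (N.cross / N.sta (N.top 1)) / θ := by ring
    rw [e, cross_div_sta hX, div_le_iff₀ hθ]
    have h3 : ρ ^ t ≤ Real.exp (-((2 - l') * R * m)) := by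
      have h5 : ρ ^ t = Real.exp (-(R * ((1 - δ) * N.v * t))) := by
        rw [hNv, hR]
        have : -(-Real.log ρ / ((1 - δ) * v) * ((1 - δ) * v * t)) = t * Real.log ρ := by
          field_simp
        rw [this, Real.exp_nat_mul, Real.exp_log hρ0]
      rw [h5, Real.exp_le_exp]
      nlinarith
    have hv1 : N.v ^ 2 ≤ 1 := pow_le_one₀ N.v_pos.le N.v_lt_one.le
    calc ρ ^ t * (Real.exp (κ * N.m) * N.v ^ 2 * N.W)
        ≤ Real.exp (-((2 - l') * R * m)) * (Real.exp (κ * N.m) * 1 * 2) := by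
          have := N.W_pos
          gcongr
      _ = Real.exp (-(((2 - l') * R - κ) * m)) * 2 := by
          rw [hNm, mul_one, ← mul_assoc, ← Real.exp_add]
          ring_nf
      _ ≤ (1 - ε) / 4 * θ := by linarith
  have h6 := ends_le (N := N) hδ0 hδ1 hz hθ (by linarith) hr hcross t
  have h7 := le_dSep (dLazy δ N.P) N.sta t (N.top 0) (N.top 1)
  linarith

end Net

namespace Net

variable {N : Net}

theorem eventually_eighth_lt_dSep {δ l : ℝ} (hδ0 : 0 < δ) (hδ1 : δ < 1) (hl : 0 < l)
    (hl1 : l ≤ 1) :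
    ∀ᶠ m : ℕ in atTop, ∀ N : Net, N.m = m → N.τ = 1 / (m : ℝ) ^ 2 → N.r ≤ 1 / 16 →
      ∃ t : ℕ, (2 - l) * m ≤ (1 - δ) * N.v * t + 1 ∧ 1 / 8 < dSep (dLazy δ N.P) N.sta t := by
  obtain ⟨z, hz, hev⟩ := eventually_decay_le hδ0 hδ1 hl (by norm_num : (0 : ℝ) < 1 / 16)
  filter_upwards [hev, eventually_ge_atTop 64] with m h1 hm N hNm hτ hr
  have hm' : (64 : ℝ) ≤ m := by exact_mod_cast hm
  obtain ⟨t, ht1, ht2⟩ := N.exists_time hδ0 hδ1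
    (by nlinarith : 0 ≤ (2 - l) * m - 1)
  refine ⟨t, by linarith, ?_⟩
  have h2 := h1 N hNm t (by linarith)
  have h3 := far_le (N := N) (θ := 1 / 4) hδ0 hδ1 hz (by norm_num) (by norm_num)
    (by norm_num; linarith) t
  have h4 := le_dSep (dLazy δ N.P) N.sta t (N.top 2) (N.top 0)
  have hW : N.W ≤ 5 / 4 := by
    refine (W_le_two (by omega) hNm hτ).trans ?_
    have : (16 : ℝ) / m ≤ 1 / 4 := by
      rw [div_le_iff₀ (by linarith)]
      linarith
    linarith
  have h5 := N.isProb_sta.1 none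
  have h6 : ((1 + 1 / 4 : ℝ) / 2 + (δ + (1 - δ) * N.drift z⁻¹) ^ t * z⁻¹ ^ (2 * N.m)) / N.sta none
      ≤ 11 / 16 * (5 / 4) := by
    rw [div_eq_mul_one_div]
    exact mul_le_mul (by linarith) (inv_sta_root_le.trans hW) (one_div_nonneg.2 h5.le)
      (by norm_num)
  linarith

/-- The number of levels to descend before reaching the root, when the chord can be used. -/
def depth : N.Vx → ℕ
  | none => 0
  | some x => if x.1 = 2 then N.m - N.k else x.2 + 1

theorem depth_le (x : N.Vx) : depth x ≤ N.m := by
  rcases x with _ | ⟨b, i⟩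
  · exact Nat.zero_le _
  · have := i.2
    simp only [depth]
    split_ifs <;> omega

theorem eventually_hit_of_depth {δ l : ℝ} (hδ0 : 0 < δ) (hδ1 : δ < 1) (hl : 0 < l) :
    ∀ᶠ m : ℕ in atTop, ∀ N : Net, N.m = m → N.τ = 1 / (m : ℝ) ^ 2 → 2 * N.k ≤ N.m →
      ∀ s : ℕ, (1 - δ) * N.v * s ≤ 4 * m → ∀ x : N.Vx, depth x + l * m ≤ (1 - δ) * N.v * s →
        3 / 8 ≤ (dLazy δ N.P ^ s) x none := by
  have hδ : 0 < 1 - δ := by linarith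
  filter_upwards [eventually_root_hit hδ0 hδ1 hl (by positivity : 0 < 8 / (1 - δ))
    (by norm_num : (0 : ℝ) < 1 / 8)] with m h N hNm hτ hk s hs x hx
  obtain ⟨h1, h2⟩ := h N hNm hτ s (time_bound hδ1 hs)
  by_cases hx' : height x ≤ depth x
  · have h3 : (height x : ℝ) ≤ depth x := by exact_mod_cast hx'
    have := h1 x (by linarith)
    linarith
  · rcases x with _ | ⟨b, i⟩
    · simp [height, depth] at hx'
    · by_cases hb : b = 2
      · subst hb
        simp only [height, depth, if_true] at hx' hx
        have hi := i.2
        have h3 : (((i : ℕ) + 1 - N.k : ℕ) : ℝ) ≤ (N.m - N.k : ℕ) := by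
          exact_mod_cast (by omega)
        have := h2 i (by omega) (by linarith)
        linarith
      · simp [height, depth, hb] at hx'

/-- If the crossing is so strong that waiting for the crossing beats every other strategy, then the
chain is fairly well mixed as soon as the third branch is. -/
theorem eventually_dSep_le_seven_eighths {δ κ r v : ℝ} {J : ℕ} (hδ0 : 0 < δ) (hδ1 : δ < 1)
    (hr : 0 < r) (hv : 0 < v) (hJ : 2 ≤ J)
    (hκ : 2 * (-Real.log δ / ((1 - δ) * v)) + -Real.log ((1 - δ) * (r / (1 + r))) / J < κ) :
    ∀ᶠ m : ℕ in atTop, ∀ N : Net, N.m = m → N.τ = 1 / (m : ℝ) ^ 2 → N.v = v → N.r = r →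
      N.m = J * N.k → N.X = Real.exp (κ * N.m) * (N.τ * N.r ^ (N.m - 1)) ^ 2 →
      ∃ t : ℕ, (1 - δ) * N.v * t ≤ (2 - 1 / J / 2) * m + 1 ∧
        dSep (dLazy δ N.P) N.sta t ≤ 7 / 8 := by
  have hδ : 0 < 1 - δ := by linarith
  have hJ0 : (0 : ℝ) < J := by
    have : 0 < J := by omega
    exact_mod_cast this
  set α : ℝ := 1 / J with hα
  have hα0 : 0 < α := by positivity
  have hα1 : α ≤ 1 / 2 := by
    rw [hα, div_le_iff₀ hJ0]
    have : (2 : ℝ) ≤ J := by exact_mod_cast hJ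
    linarith
  set L := -Real.log δ / ((1 - δ) * v) with hL
  have hL0 : 0 ≤ L := div_nonneg (by linarith [Real.log_nonpos hδ0.le hδ1.le]) (by positivity)
  set β := (1 - δ) * (r / (1 + r)) with hβ
  have hβ0 : 0 < β := by positivity
  have hc : 0 < κ - (2 * L + -Real.log β / J) := by linarith
  filter_upwards [eventually_hit_of_depth hδ0 hδ1 (by positivity : 0 < α / 8),
    eventually_exp_neg_le hc (by positivity : 0 < 2 * (1 - δ)),
    eventually_div_le (4 / α) one_pos, eventually_gt_atTop 0]
    with m hhit hexp hmα hm N hNm hτ hNv hNr hmk hX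
  have hm0 : (0 : ℝ) < m := by exact_mod_cast hm
  have hmα' : 4 ≤ α * m := by
    rw [div_le_one hm0, div_le_iff₀ hα0] at hmα
    linarith
  have hkα : (N.k : ℝ) = α * m := by
    rw [← hNm, hmk, hα]
    push_cast
    field_simp
  have hαm : α * m ≤ 1 / 2 * m := mul_le_mul_of_nonneg_right hα1 hm0.le
  have h2k : 2 * N.k ≤ N.m := by
    rw [hmk]
    exact Nat.mul_le_mul_right _ hJ
  have hit := hhit N hNm hτ h2k
  obtain ⟨t, ht1, ht2⟩ := N.exists_time hδ0 hδ1
    (mul_nonneg (by linarith : 0 ≤ 2 - α / 2) hm0.le)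
  refine ⟨t, ht2, ?_⟩
  have hV := N.speed_pos hδ1
  have hdepth (x : N.Vx) : (depth x : ℝ) ≤ m := by exact_mod_cast hNm ▸ depth_le x
  have hsum : ∀ x y : N.Vx, depth x + depth y + N.k ≤ 2 * N.m →
      1 / 8 ≤ (dLazy δ N.P ^ t) x y / N.sta y := by
    intro x y hxy
    have hxy' : (depth x : ℝ) + depth y + α * m ≤ 2 * m := by
      rw [← hkα, ← hNm]
      exact_mod_cast hxy
    obtain ⟨s, hs1, hs2⟩ := N.exists_time hδ0 hδ1
      (by positivity : 0 ≤ (depth x : ℝ) + α / 8 * m)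
    have hst : s ≤ t := by
      have h1 := hdepth x
      have h2 : (1 - δ) * N.v * s ≤ (1 - δ) * N.v * t := by linarith
      exact_mod_cast le_of_mul_le_mul_left h2 hV
    have hu : (1 - δ) * N.v * (t - s : ℕ) = (1 - δ) * N.v * t - (1 - δ) * N.v * s := by
      rw [Nat.cast_sub hst]
      ring
    have h1 := hit s (by linarith [hdepth x]) x hs1
    have h3 : (0 : ℝ) ≤ depth x := Nat.cast_nonneg _
    have h2 := hit (t - s) (by rw [hu]; nlinarith) y (by rw [hu]; linarith)
    have h3 := meet_root hδ0 hδ1 (by norm_num) (by norm_num) h1 h2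
    rw [Nat.add_sub_cancel' hst] at h3
    linarith
  have hends : 1 / 8 ≤ ((1 - δ) * (N.r / (1 + N.r))) ^ N.k *
      (δ ^ t * ((1 - δ) * N.cross)) / N.sta (N.top 0) := by
    have h1 : ((1 - δ) * (N.r / (1 + N.r))) ^ N.k = Real.exp (-(-Real.log β / J * m)) := by
      have : -(-Real.log β / J * m) = N.k * Real.log β := by
        rw [hkα, hα]; ring
      rw [hNr, ← hβ, this, Real.exp_nat_mul, Real.exp_log hβ0]
    have h2 : Real.exp (-(L * (2 * m))) ≤ δ ^ t := by
      have h3 : δ ^ t = Real.exp (-(L * ((1 - δ) * N.v * t))) := by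
        have : -(L * ((1 - δ) * v * t)) = t * Real.log δ := by
          rw [hL]
          field_simp
        rw [hNv, this, Real.exp_nat_mul, Real.exp_log hδ0]
      rw [h3, Real.exp_le_exp]
      have : L * ((1 - δ) * N.v * t) ≤ L * (2 * m) :=
        mul_le_mul_of_nonneg_left (by linarith) hL0
      linarith
    have h4 : 1 / 4 ≤ N.v ^ 2 := by nlinarith [N.half_le_v]
    have e : ((1 - δ) * (N.r / (1 + N.r))) ^ N.k * (δ ^ t * ((1 - δ) * N.cross)) / N.sta (N.top 0) =
        ((1 - δ) * (N.r / (1 + N.r))) ^ N.k * δ ^ t * (1 - δ) * (N.cross / N.sta (N.top 0)) := by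
      ring
    rw [e, cross_div_sta hX, h1]
    have hW := N.W_ge
    calc (1 / 8 : ℝ) = (2 * (1 - δ))⁻¹ * (1 - δ) * (1 / 4 * 1) := by
          field_simp
          norm_num
      _ ≤ (Real.exp (-((κ - (2 * L + -Real.log β / J)) * m)))⁻¹ * (1 - δ) * (1 / 4 * 1) := by
          gcongr
      _ = Real.exp (-(-Real.log β / J * m)) * Real.exp (-(L * (2 * m))) * (1 - δ) *
          (Real.exp (κ * N.m) * (1 / 4) * 1) := by
          rw [hNm, ← Real.exp_neg]
          have : -(-((κ - (2 * L + -Real.log β / J)) * m)) =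
            -(-Real.log β / J * m) + -(L * (2 * m)) + κ * m := by ring
          rw [this, Real.exp_add, Real.exp_add]
          ring
      _ ≤ _ := by gcongr
  have hkt : N.k < t := by
    have h1 := N.speed_le_one hδ0
    have h2 : (1 - δ) * N.v * t ≤ t := mul_le_of_le_one_left (Nat.cast_nonneg t) h1
    have : (N.k : ℝ) < t := by linarith
    exact_mod_cast this
  have : dSep (dLazy δ N.P) N.sta t ≤ 1 - 1 / 8 := by
    refine dSep_le fun x y => ?_
    by_cases hxy : depth x + depth y + N.k ≤ 2 * N.m
    · exact hsum x y hxy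
    · have hx := depth_le x
      have hy := depth_le y
      rcases x with _ | ⟨b, i⟩
      · have h0 : depth (N := N) none = 0 := rfl
        have := N.hkm
        omega
      · rcases y with _ | ⟨b', j⟩
        · have h0 : depth (N := N) none = 0 := rfl
          have := N.hkm
          omega
        · have hkm := N.hkm
          simp only [depth] at hxy hx hy
          have hb : b ≠ 2 := by
            rintro rfl
            simp only [if_true] at hxy
            omega
          have hb' : b' ≠ 2 := by
            rintro rfl
            simp only [if_true] at hxy
            omega
          rw [if_neg hb] at hx hxy
          rw [if_neg hb'] at hy hxy
          exact hends.trans (near_ends_ge hδ0 hδ1 hb hb' i j (by omega) hkt)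
  linarith

end Net

theorem exists_fin_model [Nonempty V] {P : Matrix V V ℝ} {π : V → ℝ} (h1 : IsStoch P)
    (h2 : IsProb π) (h3 : Rev P π) (h4 : Irred P) :
    ∃ (N : ℕ) (P' : Matrix (Fin N) (Fin N) ℝ) (π' : Fin N → ℝ), 0 < N ∧ IsStoch P' ∧ IsProb π' ∧
      Rev P' π' ∧ Irred P' ∧ ∀ δ ε, sepTime (dLazy δ P') π' ε = sepTime (dLazy δ P) π ε := by
  set e := (Fintype.equivFin V).symm
  refine ⟨Fintype.card V, P.submatrix e e, π ∘ e, Fintype.card_pos, ⟨fun i j => h1.1 _ _, fun i => ?_⟩,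
    ⟨fun i => h2.1 _, ?_⟩, fun i j => h3 _ _, fun i j => ?_, fun δ ε => ?_⟩
  · rw [← h1.2 (e i)]
    exact e.sum_comp (fun y => P (e i) y)
  · rw [← h2.2]
    exact e.sum_comp π
  · obtain ⟨t, ht⟩ := h4 (e i) (e j)
    exact ⟨t, by rwa [submatrix_pow]⟩
  · rw [dLazy_submatrix, sepTime_submatrix]

theorem neg_log_div_lt {p q : ℝ} (hp : 0 < p) (hpq : p < q) (hq : q < 1) :
    -Real.log q / (1 - q) < -Real.log p / (1 - p) := by
  have hp1 : 0 < 1 - p := by linarith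
  have hq1 : 0 < 1 - q := by linarith
  have h := strictConcaveOn_log_Ioi.2 (Set.mem_Ioi.2 hp) (Set.mem_Ioi.2 one_pos)
    (by linarith : p ≠ 1) (div_pos hq1 hp1) (div_pos (sub_pos.2 hpq) hp1) (by field_simp; ring)
  have e : (1 - q) / (1 - p) * p + (q - p) / (1 - p) * 1 = q := by field_simp; ring
  simp only [smul_eq_mul, Real.log_one, mul_zero, add_zero, e] at h
  rw [div_mul_eq_mul_div, div_lt_iff₀ hp1] at h
  rw [div_lt_div_iff₀ hq1 hp1]
  linarith

/-- The choice of the parameters of the networks. -/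
theorem exists_params {p q : ℝ} (hp : 0 < p) (hpq : p < q) (hq : q < 1) :
    ∃ (θ κ : ℝ) (J : ℕ), 0 < θ ∧ θ ≤ 1 / 4 ∧ 2 ≤ J ∧ Real.exp κ * θ ^ 2 ≤ 1 / 2 ∧
      κ * ((1 - θ ^ 2) / (1 + θ ^ 2)) < 2 * (-Real.log (p + (1 - p) * (4 * θ)) / (1 - p)) ∧
      2 * (-Real.log q / ((1 - q) * ((1 - θ ^ 2) / (1 + θ ^ 2)))) +
        -Real.log ((1 - q) * (θ ^ 2 / (1 + θ ^ 2))) / J < κ := by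
  have hp1 : 0 < 1 - p := by linarith
  have hq1 : 0 < 1 - q := by linarith
  set A := -Real.log q / (1 - q) with hA
  set B := fun θ : ℝ => -Real.log (p + (1 - p) * (4 * θ)) / (1 - p) with hB
  have hB0 : B 0 = -Real.log p / (1 - p) := by simp [hB]
  have hAB : A < B 0 := hB0 ▸ neg_log_div_lt hp hpq hq
  have hcB : ContinuousAt B 0 := by
    have : p + (1 - p) * (4 * 0) ≠ 0 := by simpa using hp.ne'
    fun_prop (disch := assumption)
  have hcE : ContinuousAt (fun θ : ℝ => Real.exp (2 * (A + B 0)) * θ ^ 2) 0 := by fun_prop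
  have hev : ∀ᶠ θ : ℝ in nhdsWithin 0 (Set.Ioi 0), 0 < θ ∧ θ < 1 / 4 ∧ A < B θ ∧
      Real.exp (2 * (A + B 0)) * θ ^ 2 < 1 / 2 := by
    refine Filter.Eventually.and self_mem_nhdsWithin (nhdsWithin_le_nhds ?_)
    have h1 : ∀ᶠ θ : ℝ in nhds 0, θ < 1 / 4 := eventually_lt_nhds (by norm_num)
    have h2 := hcE.eventually_lt (continuousAt_const (y := (1 / 2 : ℝ))) (by norm_num)
    exact h1.and ((hcB.eventually_const_lt hAB).and h2)
  obtain ⟨θ, hθ0, hθ1, hAθ, hE⟩ := hev.exists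
  have hθ2 : θ ^ 2 ≤ 1 / 16 := by nlinarith
  have hθ2' : 0 < θ ^ 2 := by positivity
  set v := (1 - θ ^ 2) / (1 + θ ^ 2) with hv
  have hv2 : 1 / 2 ≤ v := by
    rw [hv, le_div_iff₀ (by linarith)]
    linarith
  have hv0 : 0 < v := by linarith
  have hA0 : 0 ≤ A := div_nonneg (by linarith [Real.log_nonpos (by linarith : 0 ≤ q) hq.le]) hq1.le
  have hBθ : B θ ≤ B 0 := by
    rw [hB0]
    refine div_le_div_of_nonneg_right ?_ hp1.le
    have := Real.log_le_log hp (by nlinarith : p ≤ p + (1 - p) * (4 * θ))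
    linarith
  have hslack : 0 < (B θ - A) / v := div_pos (by linarith) hv0
  obtain ⟨J, hJ, hJ2⟩ := ((Net.eventually_div_le (-Real.log ((1 - q) * (θ ^ 2 / (1 + θ ^ 2))))
    (half_pos hslack)).and (eventually_ge_atTop 2)).exists
  refine ⟨θ, (A + B θ) / v, J, hθ0, hθ1.le, hJ2, ?_, ?_, ?_⟩
  · refine le_trans (mul_le_mul_of_nonneg_right (Real.exp_le_exp.2 ?_) hθ2'.le) hE.le
    rw [div_le_iff₀ hv0]
    nlinarith
  · rw [div_mul_cancel₀ _ hv0.ne']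
    change A + B θ < 2 * B θ
    linarith
  · have e : 2 * (-Real.log q / ((1 - q) * v)) = 2 * A / v := by
      rw [hA]
      field_simp
    have e2 : (A + B θ) / v = 2 * A / v + (B θ - A) / v := by ring
    rw [e, e2]
    linarith

theorem eventually_exists_net {r κ : ℝ} {J : ℕ} (hr0 : 0 < r) (hr : r ≤ 1 / 16) (hJ : 2 ≤ J)
    (hκ : Real.exp κ * r ≤ 1 / 2) :
    ∀ᶠ k : ℕ in atTop, ∃ N : Net, N.m = J * k ∧ N.k = k ∧ N.r = r ∧
      N.τ = 1 / ((J * k : ℕ) : ℝ) ^ 2 ∧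
      N.X = Real.exp (κ * N.m) * (N.τ * N.r ^ (N.m - 1)) ^ 2 := by
  have h1 : Tendsto (fun n : ℕ => (1 / 2 : ℝ) ^ n) atTop (nhds 0) :=
    tendsto_pow_atTop_nhds_zero_of_lt_one (by norm_num) (by norm_num)
  filter_upwards [eventually_ge_atTop 2,
    h1.eventually_le_const (by positivity : 0 < 2 * r ^ 2)] with k hk hk2
  have hkm : k < J * k := by nlinarith
  have hm : (1 : ℝ) ≤ (J * k : ℕ) := by exact_mod_cast (by omega)
  have hτ : 1 / ((J * k : ℕ) : ℝ) ^ 2 ≤ 1 := by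
    rw [div_le_one (by positivity)]
    nlinarith
  have hτ0 : 0 < 1 / ((J * k : ℕ) : ℝ) ^ 2 := by positivity
  set m := J * k with hmdef
  set τ := 1 / (m : ℝ) ^ 2
  refine ⟨⟨m, k, r, τ, Real.exp (κ * m) * (τ * r ^ (m - 1)) ^ 2, hk, hkm, hr0, by linarith, hτ0,
    by positivity, ?_⟩, rfl, rfl, rfl, rfl, rfl⟩
  have h2 : Real.exp (κ * m) * r ^ m ≤ 2 * r ^ 2 := by
    calc Real.exp (κ * m) * r ^ m = (Real.exp κ * r) ^ m := by
          rw [mul_pow, ← Real.exp_nat_mul, mul_comm κ]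
      _ ≤ (1 / 2) ^ m := pow_le_pow_left₀ (by positivity) hκ m
      _ ≤ (1 / 2) ^ k := pow_le_pow_of_le_one (by norm_num) (by norm_num) hkm.le
      _ ≤ _ := hk2
  have h3 : r ^ m = r ^ (m - 1) * r := by
    rw [← pow_succ]
    congr 1
    omega
  have h4 : Real.exp (κ * m) * r ^ (m - 1) ≤ 2 * r := by
    rw [h3] at h2
    exact le_of_mul_le_mul_right (by linarith) hr0
  have h5 : Real.exp (κ * m) * (τ * r ^ (m - 1)) ≤ 2 * r / (1 - r) := by
    calc Real.exp (κ * m) * (τ * r ^ (m - 1)) = τ * (Real.exp (κ * m) * r ^ (m - 1)) := by ring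
      _ ≤ 1 * (2 * r) := mul_le_mul hτ h4 (by positivity) one_pos.le
      _ ≤ 2 * r / (1 - r) := by
        rw [one_mul, le_div_iff₀ (by linarith)]
        nlinarith
  have h6 : 0 ≤ τ * r ^ (m - 1) := by positivity
  calc Real.exp (κ * m) * (τ * r ^ (m - 1)) ^ 2
      = τ * r ^ (m - 1) * (Real.exp (κ * m) * (τ * r ^ (m - 1))) := by ring
    _ ≤ _ := mul_le_mul_of_nonneg_left h5 h6

/-- A sequence of networks with the prescribed parameters. -/
theorem exists_nets {r κ : ℝ} {J : ℕ} (hr0 : 0 < r) (hr : r ≤ 1 / 16) (hJ : 2 ≤ J)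
    (hκ : Real.exp κ * r ≤ 1 / 2) :
    ∃ N : ℕ → Net, Tendsto (fun n => (N n).m) atTop atTop ∧ ∀ n,
      (N n).m = J * (N n).k ∧ (N n).r = r ∧ (N n).τ = 1 / ((N n).m : ℝ) ^ 2 ∧
      (N n).X = Real.exp (κ * (N n).m) * ((N n).τ * (N n).r ^ ((N n).m - 1)) ^ 2 := by
  obtain ⟨k₀, hk⟩ := eventually_atTop.1 (eventually_exists_net hr0 hr hJ hκ)
  choose N h1 h2 h3 h4 h5 using fun n : ℕ => hk (k₀ + n) (Nat.le_add_right _ _)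
  refine ⟨N, ?_, fun n => ⟨by rw [h1, h2], h3 n, by rw [h4, h1], h5 n⟩⟩
  refine tendsto_atTop_mono (fun n => ?_) tendsto_id
  rw [h1, id]
  nlinarith

/-- Sharp two-sided bounds on separation times imply separation cutoff. -/
theorem tendsto_ratio {c : ℝ} (hc : 0 < c) {m S S' : ℕ → ℕ} (hm : ∀ n, 0 < m n)
    (hS : ∀ l : ℝ, 0 < l → l ≤ 1 → ∀ᶠ n in atTop, (2 - l) * m n ≤ c * S n ∧ c * S n ≤ (2 + l) * m n)
    (hS' : ∀ l : ℝ, 0 < l → l ≤ 1 →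
      ∀ᶠ n in atTop, (2 - l) * m n ≤ c * S' n ∧ c * S' n ≤ (2 + l) * m n) :
    Tendsto (fun n => (S n : ℝ) / S' n) atTop (nhds 1) := by
  have key : ∀ T : ℕ → ℕ, (∀ l : ℝ, 0 < l → l ≤ 1 →
      ∀ᶠ n in atTop, (2 - l) * m n ≤ c * T n ∧ c * T n ≤ (2 + l) * m n) →
      Tendsto (fun n => c * T n / m n) atTop (nhds 2) := by
    intro T hT
    rw [Metric.tendsto_nhds]
    intro e he
    filter_upwards [hT (min 1 (e / 2)) (lt_min one_pos (half_pos he)) (min_le_left _ _)] with n hn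
    have hmn : (0 : ℝ) < m n := by exact_mod_cast hm n
    have h2 := min_le_right 1 (e / 2)
    have h3 : 2 - min 1 (e / 2) ≤ c * T n / m n := by
      rw [le_div_iff₀ hmn]
      exact hn.1
    have h4 : c * T n / m n ≤ 2 + min 1 (e / 2) := by
      rw [div_le_iff₀ hmn]
      exact hn.2
    rw [Real.dist_eq, abs_lt]
    constructor <;> linarith
  have h := (key S hS).div (key S' hS') two_ne_zero
  rw [div_self two_ne_zero] at h
  refine h.congr fun n => ?_
  have hmn : (0 : ℝ) < m n := by exact_mod_cast hm n
  change c * S n / m n / (c * S' n / m n) = _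
  rw [div_div_div_cancel_right₀ hmn.ne', mul_div_mul_left _ _ hc.ne']

theorem exists_cutoff_only_left {p q : ℝ} (hp : 0 < p) (hpq : p < q) (hq : q < 1) :
    ∃ (N : ℕ → ℕ) (P : ∀ n, Matrix (Fin (N n)) (Fin (N n)) ℝ) (π : ∀ n, Fin (N n) → ℝ),
      (∀ n, 0 < N n) ∧ (∀ n, IsStoch (P n)) ∧ (∀ n, IsProb (π n)) ∧ (∀ n, Rev (P n) (π n)) ∧
      (∀ n, Irred (P n)) ∧
      (∀ ε : ℝ, 0 < ε → ε ≤ 1 / 2 → Tendsto (fun n => (sepTime (dLazy p (P n)) (π n) ε : ℝ) /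
        (sepTime (dLazy p (P n)) (π n) (1 - ε) : ℝ)) atTop (nhds 1)) ∧
      ¬ ∀ ε : ℝ, 0 < ε → ε ≤ 1 / 2 → Tendsto (fun n => (sepTime (dLazy q (P n)) (π n) ε : ℝ) /
        (sepTime (dLazy q (P n)) (π n) (1 - ε) : ℝ)) atTop (nhds 1) := by
  have hq0 : 0 < q := hp.trans hpq
  have hp1 : p < 1 := hpq.trans hq
  obtain ⟨θ, κ, J, hθ0, hθ1, hJ, hκE, hκp, hκq⟩ := exists_params hp hpq hq
  have hθ2 : θ ^ 2 ≤ 1 / 16 := by nlinarith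
  have hθ2' : 0 < θ ^ 2 := by positivity
  obtain ⟨N, hm, hN⟩ := exists_nets hθ2' hθ2 hJ hκE
  set v := (1 - θ ^ 2) / (1 + θ ^ 2) with hv
  have hv0 : 0 < v := div_pos (by linarith) (by linarith)
  have hNv (n : ℕ) : (N n).v = v := by rw [Net.v, (hN n).2.1]
  have hcross (n : ℕ) : (N n).cross ≤ θ := by
    have h1 := (N n).cross_le
    have h2 := (N n).one_sub_v_le
    rw [(hN n).2.1] at h2
    nlinarith
  have hex {δ : ℝ} (hδ0 : 0 < δ) (hδ1 : δ < 1) {ε l : ℝ} (hε : 0 < ε) (hε1 : ε < 1)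
      (hl : 0 < l) (hl1 : l ≤ 1) : ∀ᶠ n in atTop, ∃ t : ℕ,
        (1 - δ) * v * t ≤ (2 + l) * (N n).m ∧ dSep (dLazy δ (N n).P) (N n).sta t ≤ ε := by
    filter_upwards [hm.eventually (Net.eventually_dSep_le hδ0 hδ1 hε hε1 hl hl1)] with n hn
    have := hn (N n) rfl (hN n).2.2.1
    rwa [hNv] at this
  choose M P π h1 h2 h3 h4 h5 h6 using fun n =>
    exists_fin_model (N n).isStoch_P (N n).isProb_sta (N n).rev_P (N n).irred_P
  refine ⟨M, P, π, h1, h2, h3, h4, h5, fun ε hε hε2 => ?_, fun hcut => ?_⟩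
  · simp only [h6]
    have main : ∀ ε : ℝ, 0 < ε → ε < 1 → ∀ l : ℝ, 0 < l → l ≤ 1 → ∀ᶠ n in atTop,
        (2 - l) * (N n).m ≤ (1 - p) * v * sepTime (dLazy p (N n).P) (N n).sta ε ∧
        (1 - p) * v * sepTime (dLazy p (N n).P) (N n).sta ε ≤ (2 + l) * (N n).m := by
      intro ε hε hε1 l hl hl1
      have hpv : 0 < (1 - p) * v := mul_pos (by linarith) hv0
      filter_upwards [hex hp hp1 hε hε1 hl hl1, hm.eventually (Net.eventually_lt_dSep hp hp1 hε1
        hl hθ0 (by linarith) hv0 hκp)] with n ⟨t, ht1, ht2⟩ hn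
      obtain ⟨s, hs1, hs2⟩ := hn (N n) rfl (hN n).2.2.1 (hNv n) (hN n).2.1.le (hcross n)
        (hN n).2.2.2
      rw [hNv] at hs1
      have hs3 : (s : ℝ) ≤ sepTime (dLazy p (N n).P) (N n).sta ε := by
        exact_mod_cast (lt_sepTime (Net.isStoch_lazy hp hp1) hs2 ⟨t, ht2⟩).le
      have ht3 : (sepTime (dLazy p (N n).P) (N n).sta ε : ℝ) ≤ t := by
        exact_mod_cast sepTime_le ht2
      exact ⟨hs1.trans (mul_le_mul_of_nonneg_left hs3 hpv.le),
        (mul_le_mul_of_nonneg_left ht3 hpv.le).trans ht1⟩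
    exact tendsto_ratio (mul_pos (by linarith) hv0) (fun n => (N n).m_pos)
      (main ε hε (by linarith)) (main (1 - ε) (by linarith) (by linarith))
  · have hcut' := hcut (1 / 8) (by norm_num) (by norm_num)
    simp only [h6] at hcut'
    have hJ' : (2 : ℝ) ≤ J := by exact_mod_cast hJ
    set α : ℝ := 1 / J with hα
    have hα0 : 0 < α := by positivity
    have hα1 : α ≤ 1 / 2 := one_div_le_one_div_of_le two_pos hJ'
    have hqv : 0 < (1 - q) * v := mul_pos (by linarith) hv0
    have hlt : (1 : ℝ) < 1 + α / 16 := by linarith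
    obtain ⟨n, hn0, hn1, ⟨t, ht1, ht2⟩, hn3, hn4, hn5⟩ := ((hcut'.eventually_const_lt zero_lt_one).and
      ((hcut'.eventually_lt_const hlt).and
      ((hex hq0 hq (by norm_num : (0 : ℝ) < 1 / 8) (by norm_num) one_pos le_rfl).and
      ((hm.eventually (Net.eventually_eighth_lt_dSep hq0 hq (by positivity : 0 < α / 4)
        (by linarith))).and
      ((hm.eventually (Net.eventually_dSep_le_seven_eighths hq0 hq hθ2' hv0 hJ hκq)).and
      (hm.eventually (Net.eventually_div_le 32 hα0))))))).exists
    obtain ⟨s, hs1, hs2⟩ := hn3 (N n) rfl (hN n).2.2.1 ((hN n).2.1.le.trans hθ2)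
    obtain ⟨u, hu1, hu2⟩ := hn4 (N n) rfl (hN n).2.2.1 (hNv n) (hN n).2.1 (hN n).1 (hN n).2.2.2
    rw [hNv] at hs1 hu1
    have hm0 : (0 : ℝ) < (N n).m := by exact_mod_cast (N n).m_pos
    rw [div_le_iff₀ hm0] at hn5
    set S := sepTime (dLazy q (N n).P) (N n).sta (1 / 8)
    set S' := sepTime (dLazy q (N n).P) (N n).sta (1 - 1 / 8)
    have hS1 : (s : ℝ) ≤ S := by
      exact_mod_cast (lt_sepTime (Net.isStoch_lazy hq0 hq) hs2 ⟨t, ht2⟩).le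
    have hS2 : (S' : ℝ) ≤ u := by
      exact_mod_cast sepTime_le (by norm_num; linarith)
    have h7 : (1 - q) * v * s ≤ (1 - q) * v * S := mul_le_mul_of_nonneg_left hS1 hqv.le
    have h8 : (1 - q) * v * S' ≤ (1 - q) * v * u := mul_le_mul_of_nonneg_left hS2 hqv.le
    have hS0 : (0 : ℝ) < S' := by
      rcases (Nat.cast_nonneg (α := ℝ) S').eq_or_lt with h0 | h0
      · rw [← h0, div_zero] at hn0
        linarith
      · exact h0
    rw [div_lt_iff₀ hS0] at hn1
    have h9 := mul_lt_mul_of_pos_left hn1 hqv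
    nlinarith

/-- **Remark 1.3.** For every `p ≠ q` in `(0,1)` there is a sequence of finite irreducible
reversible chains such that exactly one of the sequences of `p`-lazy and `q`-lazy versions
exhibits separation cutoff. -/
theorem sep_cutoff_sensitive_to_holding_probability
    (p q : ℝ) (hp0 : 0 < p) (hp1 : p < 1) (hq0 : 0 < q) (hq1 : q < 1) (hpq : p ≠ q) :
    ∃ (N : ℕ → ℕ) (P : ∀ n, Matrix (Fin (N n)) (Fin (N n)) ℝ) (π : ∀ n, Fin (N n) → ℝ),
      (∀ n, 0 < N n) ∧
      (∀ n, IsStoch (P n)) ∧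
      (∀ n, IsProb (π n)) ∧
      (∀ n, Rev (P n) (π n)) ∧
      (∀ n, Irred (P n)) ∧
      Xor'
        (∀ ε : ℝ, 0 < ε → ε ≤ 1/2 →
          Tendsto
            (fun n => (sepTime (dLazy p (P n)) (π n) ε : ℝ) /
              (sepTime (dLazy p (P n)) (π n) (1 - ε) : ℝ))
            atTop (nhds 1))
        (∀ ε : ℝ, 0 < ε → ε ≤ 1/2 →
          Tendsto
            (fun n => (sepTime (dLazy q (P n)) (π n) ε : ℝ) /
              (sepTime (dLazy q (P n)) (π n) (1 - ε) : ℝ))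
            atTop (nhds 1)) := by
  rcases lt_or_gt_of_ne hpq with h | h
  · obtain ⟨N, P, π, h1, h2, h3, h4, h5, h6, h7⟩ := exists_cutoff_only_left hp0 h hq1
    exact ⟨N, P, π, h1, h2, h3, h4, h5, Or.inl ⟨h6, h7⟩⟩
  · obtain ⟨N, P, π, h1, h2, h3, h4, h5, h6, h7⟩ := exists_cutoff_only_left hq0 h hp1
    exact ⟨N, P, π, h1, h2, h3, h4, h5, Or.inr ⟨h6, h7⟩⟩

end
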